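/- arXiv:1212.4597 — 6 statements merged into one kernel-verified Lean document; each statement's English description precedes it below -/
import Mathlib

section
/- Let n = 2. Every quasi-identity P of M_2 that involves only the noncommuting variables x_1 and x_2 and the commutative variables x_{ij}^{(1)}, x_{ij}^{(2)} (1 ≤ i,j ≤ 2) is a consequence of the Cayley–Hamilton identity, i.e. P lies in the T-ideal of C⟨X⟩ generated by q_2. -/
open scoped TensorProduct

variable (F : Type*) [Field F] [CharZero F] (n : ℕ)

/-- The commutative coefficient ring `C = F[x_{ij}^{(k)}]`. -/
abbrev CPoly := MvPolynomial (Fin n × Fin n × ℕ) F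

/-- The algebra of quasi-polynomials `C⟨X⟩`. -/
abbrev QPoly := FreeAlgebra (CPoly F n) ℕ

/-- The generic matrix `ξ_k`. -/
noncomputable def genMat (k : ℕ) : Matrix (Fin n) (Fin n) (CPoly F n) :=
  Matrix.of fun i j => MvPolynomial.X (i, j, k)

/-- `Φ : C⟨X⟩ → M_n(C)`, the `C`-algebra map sending `x_k` to `ξ_k`. -/
noncomputable def PhiQ : QPoly F n →ₐ[CPoly F n] Matrix (Fin n) (Fin n) (CPoly F n) :=
  FreeAlgebra.lift _ (genMat F n)

/-- Evaluation of `C` at a sequence of matrices. -/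
noncomputable def evalC (A : ℕ → Matrix (Fin n) (Fin n) F) : CPoly F n →ₐ[F] F :=
  MvPolynomial.aeval fun p => A p.2.2 p.1 p.2.1

/-- Evaluation `ev_A : C⟨X⟩ → M_n(F)`. -/
noncomputable def evalQ (A : ℕ → Matrix (Fin n) (Fin n) F) :
    QPoly F n →ₐ[F] Matrix (Fin n) (Fin n) F :=
  ((evalC F n A).mapMatrix).comp ((PhiQ F n).restrictScalars F)

def IsQuasiIdentity (P : QPoly F n) : Prop :=
  ∀ A : ℕ → Matrix (Fin n) (Fin n) F, evalQ F n A P = 0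

/-- Substitution endomorphisms of `C⟨X⟩`. -/
def IsSubstEndo (φ : QPoly F n →ₐ[F] QPoly F n) : Prop :=
  ∀ (i j : Fin n) (k : ℕ),
    φ (algebraMap (CPoly F n) (QPoly F n) (MvPolynomial.X (i, j, k))) =
      algebraMap (CPoly F n) (QPoly F n) (PhiQ F n (φ (FreeAlgebra.ι (CPoly F n) k)) i j)

def IsTIdeal (I : Set (QPoly F n)) : Prop :=
  (0 : QPoly F n) ∈ I ∧
  (∀ a b : QPoly F n, a ∈ I → b ∈ I → a + b ∈ I) ∧
  (∀ r a : QPoly F n, a ∈ I → r * a ∈ I) ∧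
  (∀ r a : QPoly F n, a ∈ I → a * r ∈ I) ∧
  (∀ φ : QPoly F n →ₐ[F] QPoly F n, IsSubstEndo F n φ → ∀ p ∈ I, φ p ∈ I)

/-- The T-ideal generated by a set. -/
def TIdealSpan (S : Set (QPoly F n)) : Set (QPoly F n) :=
  ⋂₀ {I : Set (QPoly F n) | IsTIdeal F n I ∧ S ⊆ I}

/-- The Cayley–Hamilton quasi-polynomial `q_n`. -/
noncomputable def chQ : QPoly F n :=
  ∑ i ∈ Finset.range (n + 1),
    algebraMap (CPoly F n) (QPoly F n) ((genMat F n 0).charpoly.coeff i) *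
      FreeAlgebra.ι (CPoly F n) 0 ^ i

/-- Noncommutative polynomials over `F`. -/
abbrev NCPoly := FreeAlgebra F ℕ

noncomputable def evalNC (A : ℕ → Matrix (Fin n) (Fin n) F) :
    NCPoly F →ₐ[F] Matrix (Fin n) (Fin n) F :=
  FreeAlgebra.lift F A

def IsCentralPoly (c : NCPoly F) : Prop :=
  ∀ A : ℕ → Matrix (Fin n) (Fin n) F, ∃ α : F,
    evalNC F n A c = α • (1 : Matrix (Fin n) (Fin n) F)

def IsPolyIdentity (c : NCPoly F) : Prop :=
  ∀ A : ℕ → Matrix (Fin n) (Fin n) F, evalNC F n A c = 0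

/-- The constant term of a noncommutative polynomial. -/
noncomputable def constantTerm : NCPoly F →ₐ[F] F :=
  FreeAlgebra.lift F (fun _ : ℕ => (0 : F))

/-- The inclusion `F⟨X⟩ → C⟨X⟩`. -/
noncomputable def toQPoly : NCPoly F →ₐ[F] QPoly F n :=
  FreeAlgebra.lift F (fun k => FreeAlgebra.ι (CPoly F n) k)

/-- The subalgebra of quasi-polynomials involving only the first `m` noncommuting
variables and the commutative variables `x_{ij}^{(k)}` with `k < m`. -/
noncomputable def usesOnlyVars (m : ℕ) : Subalgebra F (QPoly F n) :=
  Algebra.adjoin F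
    ({p : QPoly F n | ∃ k < m, p = FreeAlgebra.ι (CPoly F n) k} ∪
     {p : QPoly F n | ∃ (i j : Fin n), ∃ k < m,
        p = algebraMap (CPoly F n) (QPoly F n) (MvPolynomial.X (i, j, k))})

section QuadraticRelations

variable {R B : Type*} [CommRing R] [Ring B] [Algebra R B]

/-- An algebra generated by two elements which satisfy quadratic relations of Cayley–Hamilton type
is spanned, as a module, by `1, x, y, x * y`. -/
theorem exists_eq_of_mem_adjoin_pair {x y : B} {t d s e u : R}
    (hx : x * x = t • x - d • (1 : B)) (hy : y * y = s • y - e • (1 : B))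
    (hxy : y * x = s • x + t • y - u • (1 : B) - x * y)
    {p : B} (hp : p ∈ Algebra.adjoin R {x, y}) :
    ∃ a b c f : R, p = a • (1 : B) + b • x + c • y + f • (x * y) := by
  set S : Submodule R B := Submodule.span R {1, x, y, x * y} with hS
  have h1 : (1 : B) ∈ S := Submodule.subset_span (by simp)
  have hxS : x ∈ S := Submodule.subset_span (by simp)
  have hyS : y ∈ S := Submodule.subset_span (by simp)
  have hxyS : x * y ∈ S := Submodule.subset_span (by simp)
  have left_mul {g : B} (hg1 : g ∈ S) (hgx : g * x ∈ S) (hgy : g * y ∈ S)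
      (hgxy : g * (x * y) ∈ S) : ∀ q ∈ S, g * q ∈ S := by
    suffices S ≤ S.comap (LinearMap.mulLeft R g) from fun q hq => this hq
    refine Submodule.span_le.2 ?_
    rintro q (rfl | rfl | rfl | rfl) <;> simpa
  have hxl : ∀ q ∈ S, x * q ∈ S := by
    refine left_mul hxS ?_ hxyS ?_
    · rw [hx]
      exact S.sub_mem (S.smul_mem _ hxS) (S.smul_mem _ h1)
    · rw [← mul_assoc, hx, sub_mul, smul_mul_assoc, smul_mul_assoc, one_mul]
      exact S.sub_mem (S.smul_mem _ hxyS) (S.smul_mem _ hyS)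
  have hyxS : y * x ∈ S := by
    rw [hxy]
    exact S.sub_mem (S.sub_mem (S.add_mem (S.smul_mem _ hxS) (S.smul_mem _ hyS))
      (S.smul_mem _ h1)) hxyS
  have hyyS : y * y ∈ S := by
    rw [hy]
    exact S.sub_mem (S.smul_mem _ hyS) (S.smul_mem _ h1)
  have hyl : ∀ q ∈ S, y * q ∈ S := by
    refine left_mul hyS hyxS hyyS ?_
    have : y * (x * y) = s • (x * y) + t • (y * y) - u • y - x * (y * y) := by
      rw [← mul_assoc, hxy]
      simp only [sub_mul, add_mul, smul_mul_assoc, one_mul, mul_assoc]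
    rw [this]
    exact S.sub_mem (S.sub_mem (S.add_mem (S.smul_mem _ hxyS) (S.smul_mem _ hyyS))
      (S.smul_mem _ hyS)) (hxl _ hyyS)
  have key : ∀ q ∈ S, p * q ∈ S := by
    induction hp using Algebra.adjoin_induction with
    | mem g hg =>
      rcases hg with rfl | rfl
      exacts [hxl, hyl]
    | algebraMap r =>
      intro q hq
      rw [← Algebra.smul_def]
      exact S.smul_mem _ hq
    | add g h _ _ hg hh =>
      intro q hq
      rw [add_mul]
      exact S.add_mem (hg q hq) (hh q hq)
    | mul g h _ _ hg hh =>
      intro q hq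
      rw [mul_assoc]
      exact hg _ (hh q hq)
  have hpS := key 1 h1
  rw [mul_one, hS, Submodule.mem_span_insert] at hpS
  obtain ⟨a, z, hz, rfl⟩ := hpS
  rw [Submodule.mem_span_insert] at hz
  obtain ⟨b, z, hz, rfl⟩ := hz
  obtain ⟨c, f, rfl⟩ := Submodule.mem_span_pair.1 hz
  exact ⟨a, b, c, f, by abel⟩

end QuadraticRelations

section SemilinearLift

variable {k R X B : Type*} [CommRing k] [CommRing R] [Algebra k R] [Ring B] [Algebra k B]

/-- The `k`-algebra homomorphism from the free `R`-algebra on `X` which extends a `k`-algebra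
homomorphism `f` with central values on the coefficients and a map `g` on the generators. -/
noncomputable def freeAlgebraLift (f : R →ₐ[k] B) (g : X → B) (h : ∀ r b, Commute (f r) b) :
    FreeAlgebra R X →ₐ[k] B :=
  (MonoidAlgebra.liftNCAlgHom f (FreeMonoid.lift g) fun r _ => h r _).comp
    ((FreeAlgebra.equivMonoidAlgebraFreeMonoid (R := R) (X := X)).toAlgHom.restrictScalars k)

theorem freeAlgebraLift_ι (f : R →ₐ[k] B) (g : X → B) (h : ∀ r b, Commute (f r) b) (x : X) :
    freeAlgebraLift f g h (FreeAlgebra.ι R x) = g x := by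
  simp [freeAlgebraLift, FreeAlgebra.equivMonoidAlgebraFreeMonoid]

theorem freeAlgebraLift_algebraMap (f : R →ₐ[k] B) (g : X → B) (h : ∀ r b, Commute (f r) b)
    (r : R) : freeAlgebraLift f g h (algebraMap R (FreeAlgebra R X) r) = f r := by
  simp [freeAlgebraLift]

end SemilinearLift

section CayleyHamilton

variable (F : Type*) [Field F] (n : ℕ)

/-- The action on `C` of the substitution determined by `H`. -/
noncomputable def substCoeff (H : ℕ → QPoly F n) : CPoly F n →ₐ[F] CPoly F n :=
  MvPolynomial.aeval fun p => PhiQ F n (H p.2.2) p.1 p.2.1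

/-- The substitution endomorphism of `C⟨X⟩` determined by `H`. -/
noncomputable def substEndo (H : ℕ → QPoly F n) : QPoly F n →ₐ[F] QPoly F n :=
  freeAlgebraLift ((IsScalarTower.toAlgHom F (CPoly F n) (QPoly F n)).comp (substCoeff F n H)) H
    fun c p => Algebra.commutes (substCoeff F n H c) p

theorem substEndo_ι (H : ℕ → QPoly F n) (k : ℕ) :
    substEndo F n H (FreeAlgebra.ι (CPoly F n) k) = H k :=
  freeAlgebraLift_ι ..

theorem substEndo_algebraMap (H : ℕ → QPoly F n) (c : CPoly F n) :
    substEndo F n H (algebraMap (CPoly F n) (QPoly F n) c) =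
      algebraMap (CPoly F n) (QPoly F n) (substCoeff F n H c) :=
  freeAlgebraLift_algebraMap ..

theorem substCoeff_X (H : ℕ → QPoly F n) (i j : Fin n) (k : ℕ) :
    substCoeff F n H (MvPolynomial.X (i, j, k)) = PhiQ F n (H k) i j :=
  MvPolynomial.aeval_X ..

theorem isSubstEndo_substEndo (H : ℕ → QPoly F n) : IsSubstEndo F n (substEndo F n H) := by
  intro i j k
  rw [substEndo_algebraMap, substEndo_ι, substCoeff_X]

theorem mul_self_sub_trace_smul_add_det_smul_one {R : Type*} [CommRing R]
    (M : Matrix (Fin 2) (Fin 2) R) :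
    M * M - M.trace • M + M.det • (1 : Matrix (Fin 2) (Fin 2) R) = 0 := by
  ext i j
  fin_cases i <;> fin_cases j <;>
    simp [Matrix.mul_apply, Matrix.trace_fin_two, Matrix.det_fin_two] <;> ring

/-- The Cayley–Hamilton expression of degree two evaluated at a quasi-polynomial. -/
noncomputable def chAt (a : QPoly F 2) : QPoly F 2 :=
  a * a - (PhiQ F 2 a).trace • a + (PhiQ F 2 a).det • (1 : QPoly F 2)

theorem substEndo_chQ (a : QPoly F 2) : substEndo F 2 (fun _ => a) (chQ F 2) = chAt F a := by
  have h0 : (genMat F 2 0).charpoly.coeff 0 = (genMat F 2 0).det := by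
    simp [Matrix.charpoly_fin_two]
  have h1 : (genMat F 2 0).charpoly.coeff 1 = -(genMat F 2 0).trace := by
    simp [Matrix.charpoly_fin_two, Polynomial.coeff_C]
  have h2 : (genMat F 2 0).charpoly.coeff 2 = 1 := by
    simp [Matrix.charpoly_fin_two]
  have htr : substCoeff F 2 (fun _ => a) (genMat F 2 0).trace = (PhiQ F 2 a).trace := by
    simp [genMat, Matrix.trace_fin_two, substCoeff_X]
  have hdet : substCoeff F 2 (fun _ => a) (genMat F 2 0).det = (PhiQ F 2 a).det := by
    simp [genMat, Matrix.det_fin_two, substCoeff_X]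
  have expand {R A : Type _} [CommRing R] [Ring A] [Algebra R A] (t d : R) (b : A) :
      0 + algebraMap R A d * b ^ 0 + algebraMap R A (-t) * b ^ 1 + algebraMap R A 1 * b ^ 2 =
        b * b - t • b + d • (1 : A) := by
    simp only [← Algebra.smul_def, neg_smul, one_smul, pow_zero, pow_one, pow_two]
    abel
  simp only [chQ, Finset.sum_range_succ, Finset.sum_range_zero, h0, h1, h2, map_add, map_mul,
    map_pow, map_zero, substEndo_ι, substEndo_algebraMap]
  rw [map_neg, htr, hdet, map_one]
  exact expand _ _ _

theorem PhiQ_chAt (a : QPoly F 2) : PhiQ F 2 (chAt F a) = 0 := by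
  rw [chAt, map_add, map_sub, map_mul, map_smul, map_smul, map_one]
  exact mul_self_sub_trace_smul_add_det_smul_one _

/-- The two-sided ideal of `C⟨X⟩` generated by the values of the Cayley–Hamilton expression. -/
noncomputable def chIdeal : TwoSidedIdeal (QPoly F 2) :=
  TwoSidedIdeal.span (Set.range (chAt F))

theorem chIdeal_subset_TIdealSpan : (chIdeal F : Set (QPoly F 2)) ⊆ TIdealSpan F 2 {chQ F 2} := by
  rintro p hp I ⟨⟨hzero, hadd, hleft, hright, hsubst⟩, hI⟩
  let J : TwoSidedIdeal (QPoly F 2) := TwoSidedIdeal.mk' I hzero (hadd _ _)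
    (fun {x} hx => neg_one_mul x ▸ hleft (-1) x hx) (hleft _ _) (hright _ _)
  have hJ : chIdeal F ≤ J := by
    refine TwoSidedIdeal.span_le.2 ?_
    rintro _ ⟨a, rfl⟩
    rw [← substEndo_chQ]
    exact (TwoSidedIdeal.mem_mk' ..).2 (hsubst _ (isSubstEndo_substEndo F 2 _) _ (hI rfl))
  exact (TwoSidedIdeal.mem_mk' ..).1 (hJ hp)

theorem PhiQ_eq_zero_of_mem_chIdeal {p : QPoly F 2} (hp : p ∈ chIdeal F) : PhiQ F 2 p = 0 := by
  have hle : chIdeal F ≤ TwoSidedIdeal.ker (PhiQ F 2) := by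
    refine TwoSidedIdeal.span_le.2 ?_
    rintro _ ⟨a, rfl⟩
    exact (TwoSidedIdeal.mem_ker _).2 (PhiQ_chAt F a)
  exact (TwoSidedIdeal.mem_ker _).1 (hle hp)

theorem PhiQ_eq_zero_of_isQuasiIdentity [CharZero F] {P : QPoly F n} (hP : IsQuasiIdentity F n P) :
    PhiQ F n P = 0 := by
  refine Matrix.ext fun i j => MvPolynomial.funext (R := F) fun v => ?_
  have := congrFun (congrFun (hP fun k => Matrix.of fun i j => v (i, j, k)) i) j
  simpa [evalQ, evalC, MvPolynomial.aeval_eq_eval] using this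

theorem mem_adjoin_of_mem_usesOnlyVars {P : QPoly F 2} (hP : P ∈ usesOnlyVars F 2 2) :
    P ∈ Algebra.adjoin (CPoly F 2)
      {FreeAlgebra.ι (CPoly F 2) 0, FreeAlgebra.ι (CPoly F 2) 1} := by
  induction hP using Algebra.adjoin_induction with
  | mem p hp =>
    obtain ⟨k, hk, rfl⟩ | ⟨i, j, k, -, rfl⟩ := hp
    · interval_cases k
      · exact Algebra.subset_adjoin (Set.mem_insert _ _)
      · exact Algebra.subset_adjoin (Set.mem_insert_of_mem _ rfl)
    · exact Subalgebra.algebraMap_mem _ _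
  | algebraMap r => exact Subalgebra.algebraMap_mem _ (algebraMap F (CPoly F 2) r)
  | add p q _ _ hp hq => exact add_mem hp hq
  | mul p q _ _ hp hq => exact mul_mem hp hq

/-- Modulo the Cayley–Hamilton relations, `1, x₁, x₂, x₁x₂` span the quasi-polynomials in the
first two variables. -/
theorem exists_sub_mem_chIdeal {P : QPoly F 2} (hP : P ∈ usesOnlyVars F 2 2) :
    ∃ a b c f : CPoly F 2,
      P - (a • (1 : QPoly F 2) + b • FreeAlgebra.ι (CPoly F 2) 0 + c • FreeAlgebra.ι (CPoly F 2) 1 +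
        f • (FreeAlgebra.ι (CPoly F 2) 0 * FreeAlgebra.ι (CPoly F 2) 1)) ∈ chIdeal F := by
  set x : QPoly F 2 := FreeAlgebra.ι (CPoly F 2) 0
  set y : QPoly F 2 := FreeAlgebra.ι (CPoly F 2) 1
  have hadj : P ∈ Algebra.adjoin (CPoly F 2) {x, y} := mem_adjoin_of_mem_usesOnlyVars F hP
  let π := (chIdeal F).ringCon.mkₐ (α := CPoly F 2)
  have hπ (p q : QPoly F 2) : π p = π q ↔ p - q ∈ chIdeal F := by
    rw [← TwoSidedIdeal.rel_iff]
    exact RingCon.eq _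
  have hch (a : QPoly F 2) :
      π a * π a = (PhiQ F 2 a).trace • π a -
        (PhiQ F 2 a).det • (1 : (chIdeal F).ringCon.Quotient) := by
    rw [← map_mul, ← map_smul, ← map_one π, ← map_smul, ← map_sub, hπ]
    have : chAt F a ∈ chIdeal F := TwoSidedIdeal.subset_span ⟨a, rfl⟩
    rwa [chAt, sub_add] at this
  have hxy : π y * π x = (PhiQ F 2 y).trace • π x + (PhiQ F 2 x).trace • π y -
      ((PhiQ F 2 (x + y)).det - (PhiQ F 2 x).det - (PhiQ F 2 y).det) •
        (1 : (chIdeal F).ringCon.Quotient) - π x * π y := by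
    have e : π y * π x = π (x + y) * π (x + y) - π x * π x - π y * π y - π x * π y := by
      rw [map_add]
      noncomm_ring
    rw [e, hch, hch, hch]
    simp only [map_add, Matrix.trace_add]
    module
  have hmem : π P ∈ Algebra.adjoin (CPoly F 2) {π x, π y} := by
    have : π P ∈ (Algebra.adjoin (CPoly F 2) {x, y}).map π := ⟨P, hadj, rfl⟩
    rwa [AlgHom.map_adjoin, Set.image_pair] at this
  obtain ⟨a, b, c, f, h⟩ := exists_eq_of_mem_adjoin_pair (hch x) (hch y) hxy hmem
  refine ⟨a, b, c, f, (hπ _ _).1 ?_⟩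
  simpa using h

/-- The matrices `1, ξ₁, ξ₂, ξ₁ξ₂` are linearly independent over `C`. -/
theorem eq_zero_of_genMat_combination {a b c f : CPoly F 2}
    (h : a • (1 : Matrix (Fin 2) (Fin 2) (CPoly F 2)) + b • genMat F 2 0 + c • genMat F 2 1 +
      f • (genMat F 2 0 * genMat F 2 1) = 0) : a = 0 ∧ b = 0 ∧ c = 0 ∧ f = 0 := by
  let row (i j : Fin 2) : Fin 4 → CPoly F 2 :=
    ![(1 : Matrix (Fin 2) (Fin 2) (CPoly F 2)) i j, genMat F 2 0 i j, genMat F 2 1 i j,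
      (genMat F 2 0 * genMat F 2 1) i j]
  let N : Matrix (Fin 4) (Fin 4) (CPoly F 2) := Matrix.of ![row 0 0, row 0 1, row 1 0, row 1 1]
  have hdet : N.det ≠ 0 := by
    intro h0
    let A : ℕ → Matrix (Fin 2) (Fin 2) F := fun k =>
      if k = 0 then !![0, 1; 0, 0] else !![0, 0; 1, 0]
    have := congrArg (evalC F 2 A) h0
    rw [AlgHom.map_det, map_zero] at this
    simp [N, row, A, Matrix.det_succ_row_zero, Fin.sum_univ_succ, Fin.succAbove, genMat, evalC,
      Matrix.mul_apply] at this
  have hN : N.mulVec ![a, b, c, f] = 0 := by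
    have hent (i j : Fin 2) := congrFun (congrFun h i) j
    ext1 k
    fin_cases k
    · simpa [N, row, Matrix.mulVec, dotProduct, Fin.sum_univ_succ, mul_comm, add_assoc]
        using hent 0 0
    · simpa [N, row, Matrix.mulVec, dotProduct, Fin.sum_univ_succ, mul_comm, add_assoc]
        using hent 0 1
    · simpa [N, row, Matrix.mulVec, dotProduct, Fin.sum_univ_succ, mul_comm, add_assoc]
        using hent 1 0
    · simpa [N, row, Matrix.mulVec, dotProduct, Fin.sum_univ_succ, mul_comm, add_assoc]
        using hent 1 1
  have hv := Matrix.eq_zero_of_mulVec_eq_zero hdet hN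
  exact ⟨congrFun hv 0, congrFun hv 1, congrFun hv 2, congrFun hv 3⟩

end CayleyHamilton

theorem stmt11 (F : Type*) [Field F] [CharZero F]
    (P : QPoly F 2) (hvars : P ∈ usesOnlyVars F 2 2)
    (hP : IsQuasiIdentity F 2 P) :
    P ∈ TIdealSpan F 2 {chQ F 2} := by
  obtain ⟨a, b, c, f, hmem⟩ := exists_sub_mem_chIdeal F hvars
  have hΦ := PhiQ_eq_zero_of_mem_chIdeal F hmem
  rw [map_sub, PhiQ_eq_zero_of_isQuasiIdentity F 2 hP, zero_sub, neg_eq_zero] at hΦ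
  obtain ⟨rfl, rfl, rfl, rfl⟩ := eq_zero_of_genMat_combination F (by simpa [PhiQ] using hΦ)
  exact chIdeal_subset_TIdealSpan F (by simpa using hmem)
end

section
/- Let F be a field of characteristic 0 and n ≥ 1. For all matrices A_1,…,A_{2n−1} ∈ M_n(F): n · Σ_{σ ∈ Sym(2n−1)} sgn(σ) · A_{σ(1)}A_{σ(2)}⋯A_{σ(2n−1)} = Σ_{i=0}^{n−1} Σ_{σ ∈ Sym(2n−1)} sgn(σ) · tr(A_{σ(2i+1)}A_{σ(2i+2)}⋯A_{σ(2n−1)}) · A_{σ(1)}A_{σ(2)}⋯A_{σ(2i)}, where for i = 0 the matrix product A_{σ(1)}⋯A_{σ(2i)} is understood to be the identity matrix. (This says that the element O_n = n·X^{2n−1} − Σ_{i=0}^{n−1} X^{2i} ∧ T_{n−i−1} is an antisymmetric trace identity of M_n.) -/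
namespace Matrix

open Polynomial

section Newton

variable {m S : Type*} [Fintype m] [DecidableEq m] [CommRing S]

theorem derivative_det (P : Matrix m m S[X]) :
    derivative P.det = ∑ i, (P.updateCol i fun k => derivative (P k i)).det := by
  simp only [det_apply', derivative_sum]
  rw [Finset.sum_comm]
  refine Finset.sum_congr rfl fun σ _ => ?_
  rw [← Finset.mul_sum, derivative_intCast_mul, derivative_prod_finset]
  congr 1
  refine Finset.sum_congr rfl fun i _ => ?_
  rw [← Finset.prod_erase_mul _ _ (Finset.mem_univ i)]
  congr 1
  · refine Finset.prod_congr rfl fun j hj => ?_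
    rw [updateCol_ne (Finset.ne_of_mem_erase hj)]
  · rw [updateCol_self]

theorem derivative_charpoly (M : Matrix m m S) :
    derivative M.charpoly = (adjugate (charmatrix M)).trace := by
  rw [charpoly, derivative_det, trace]
  refine Finset.sum_congr rfl fun i _ => ?_
  rw [diag_apply, ← transpose_apply (adjugate _), adjugate_transpose, adjugate_apply,
    updateRow_transpose, det_transpose]
  congr 2
  funext k
  by_cases h : k = i
  · subst h; simp
  · simp [h]

/-- Newton's identities for the coefficients of the characteristic polynomial. -/
theorem exists_newton_charpoly (M : Matrix m m S) :
    ∃ D, ∀ d, D ≤ d → ∀ k : ℕ, (k : S) * M.charpoly.coeff k =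
      ∑ i ∈ Finset.range d, M.charpoly.coeff (k + i) * (M ^ i).trace := by
  nontriviality S
  set b := matPolyEquiv (adjugate (charmatrix M)) with hb
  have hmul : b * (X - C M) = M.charpoly.map (algebraMap S (Matrix m m S)) := by
    rw [hb, ← matPolyEquiv_charmatrix, ← map_mul, adjugate_mul, matPolyEquiv_smul_one, charpoly]
  have hrec (k : ℕ) : b.coeff k = M.charpoly.coeff (k + 1) • 1 + b.coeff (k + 1) * M := by
    have := congrArg (fun q => q.coeff (k + 1)) hmul
    simp only [coeff_mul_X_sub_C, coeff_map, Algebra.algebraMap_eq_smul_one] at this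
    rw [← this, sub_add_cancel]
  have hexp (d k : ℕ) : b.coeff k =
      ∑ i ∈ Finset.range d, M.charpoly.coeff (k + 1 + i) • M ^ i + b.coeff (k + d) * M ^ d := by
    induction d with
    | zero => simp
    | succ d ih =>
      rw [ih, Finset.sum_range_succ, hrec (k + d), add_mul, smul_mul_assoc, one_mul, mul_assoc,
        ← pow_succ', add_right_comm k 1 d, ← add_assoc k d 1,
        ← add_assoc (Finset.sum _ _)]
  refine ⟨max (b.natDegree + 1) (Fintype.card m + 1), fun d hd k => ?_⟩
  cases k with
  | zero =>
    have h := congrArg trace (aeval_self_charpoly M)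
    rw [aeval_eq_sum_range' (n := d) (by rw [charpoly_natDegree_eq_dim]; lia), trace_sum] at h
    simpa [trace_smul] using h.symm
  | succ k =>
    have h := congrArg trace (hexp d k)
    rw [coeff_eq_zero_of_natDegree_lt (by lia : b.natDegree < k + d), zero_mul, add_zero,
      trace_sum] at h
    simp only [trace_smul, smul_eq_mul] at h
    rw [← h]
    have := congrArg (fun q => q.coeff k) (derivative_charpoly M)
    simp only [coeff_derivative, trace, finsetSum_coeff, diag_apply] at this
    rw [mul_comm, Nat.cast_succ, this, trace]
    simp [hb]

variable {F : Type*} [Field F] [CharZero F] [Algebra F S]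

theorem charpoly_coeff_of_trace_mul_trace_eq_zero (M : Matrix m m S)
    (hM : ∀ i j, (M ^ (i + 1)).trace * (M ^ (j + 1)).trace = 0) (j k : ℕ)
    (hjk : k + (j + 1) = Fintype.card m) :
    M.charpoly.coeff k = -(((j + 1 : ℕ) : F)⁻¹ • (M ^ (j + 1)).trace) := by
  nontriviality S
  induction j using Nat.strong_induction_on generalizing k with
  | _ j ih =>
  obtain ⟨D, hD⟩ := exists_newton_charpoly M
  have h := hD (max D (Fintype.card m + 1)) (le_max_left _ _) k
  rw [Finset.sum_eq_add 0 (j + 1) (by lia) ?_ (by simp) (by simp; lia)] at h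
  · have htop : M.charpoly.coeff (k + (j + 1)) = 1 := by
      rw [hjk, ← charpoly_natDegree_eq_dim M]
      exact M.charpoly_monic
    rw [htop, pow_zero, trace_one, add_zero, ← hjk] at h
    have h' : ((j + 1 : ℕ) : F) • M.charpoly.coeff k = -(M ^ (j + 1)).trace := by
      rw [Nat.cast_smul_eq_nsmul, nsmul_eq_mul]
      push_cast at h ⊢
      linear_combination -h
    rw [← smul_neg, ← h', inv_smul_smul₀ (Nat.cast_ne_zero.2 j.succ_ne_zero)]
  · rintro i - ⟨hi0, hij⟩
    obtain ⟨i, rfl⟩ := Nat.exists_eq_succ_of_ne_zero hi0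
    rcases lt_or_gt_of_ne hij with hlt | hgt
    · rw [ih (j - (i + 1)) (by lia) _ (by lia), neg_mul, smul_mul_assoc, hM, smul_zero, neg_zero]
    · rw [coeff_eq_zero_of_natDegree_lt, zero_mul]
      rw [charpoly_natDegree_eq_dim]
      lia

theorem pow_card_of_trace_mul_trace_eq_zero (M : Matrix m m S)
    (hM : ∀ i j, (M ^ (i + 1)).trace * (M ^ (j + 1)).trace = 0) :
    M ^ Fintype.card m = ∑ k ∈ Finset.range (Fintype.card m),
      ((Fintype.card m - k : ℕ) : F)⁻¹ •
        (M ^ k * scalar m (M ^ (Fintype.card m - k)).trace) := by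
  nontriviality S
  have h := aeval_self_charpoly M
  have htop : M.charpoly.coeff (Fintype.card m) = 1 := by
    rw [← charpoly_natDegree_eq_dim M]
    exact M.charpoly_monic
  rw [aeval_eq_sum_range, charpoly_natDegree_eq_dim, Finset.sum_range_succ, htop, one_smul,
    add_comm] at h
  rw [eq_neg_of_add_eq_zero_left h, ← Finset.sum_neg_distrib]
  refine Finset.sum_congr rfl fun k hk => ?_
  obtain ⟨j, hj⟩ := Nat.exists_eq_add_of_lt (Finset.mem_range.1 hk)
  rw [charpoly_coeff_of_trace_mul_trace_eq_zero (F := F) M hM j k (by lia),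
    show Fintype.card m - k = j + 1 by lia, neg_smul, neg_neg, smul_assoc,
    ← scalar_comm _ fun _ => Commute.all _ _, scalar_apply, smul_eq_diagonal_mul]

end Newton

section Exterior

variable {F : Type*} [Field F]

open ExteriorAlgebra

variable {V : Type*} [AddCommGroup V] [Module F V] {m : Type*} [Fintype m] [DecidableEq m]

theorem _root_.ExteriorAlgebra.ι_mul_ι_comm (u w : V) : ι F u * ι F w = -(ι F w * ι F u) :=
  eq_neg_of_add_eq_zero_left (ι_add_mul_swap u w)

theorem _root_.ExteriorAlgebra.ι_mul_ι_mul_ι_comm (u v w : V) :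
    ι F u * (ι F v * ι F w) = ι F v * ι F w * ι F u := by
  rw [← mul_assoc, ι_mul_ι_comm u v, neg_mul, mul_assoc, ι_mul_ι_comm u w, mul_neg, neg_neg,
    mul_assoc]

theorem scalar_ι_mul_map_ι (u : V) (v : Matrix m m V) :
    scalar m (ι F u) * v.map (ι F) = -(v.map (ι F) * scalar m (ι F u)) := by
  ext p q
  simp [ι_mul_ι_comm u]

theorem scalar_ι_mul_map_ι_pow (u : V) (v : Matrix m m V) (k : ℕ) :
    scalar m (ι F u) * v.map (ι F) ^ k =
      (-1 : ℤ) ^ k • (v.map (ι F) ^ k * scalar m (ι F u)) := by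
  induction k with
  | zero => simp
  | succ k ih =>
    rw [pow_succ, ← mul_assoc, ih, smul_mul_assoc, mul_assoc, scalar_ι_mul_map_ι, pow_succ (-1),
      mul_neg_one, neg_smul, mul_neg, smul_neg, mul_assoc]

theorem ι_mul_map_ι_pow_apply (u : V) (v : Matrix m m V) (k : ℕ) (p q : m) :
    ι F u * (v.map (ι F) ^ k) p q = (-1 : ℤ) ^ k • ((v.map (ι F) ^ k) p q * ι F u) := by
  simpa using congrFun₂ (scalar_ι_mul_map_ι_pow (F := F) u v k) p q

theorem ι_mul_trace_map_ι_pow_odd (u : V) (v : Matrix m m V) (k : ℕ) :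
    ι F u * (v.map (ι F) ^ (2 * k + 1)).trace = -((v.map (ι F) ^ (2 * k + 1)).trace * ι F u) := by
  simp_rw [trace, diag_apply, Finset.mul_sum, Finset.sum_mul, ι_mul_map_ι_pow_apply]
  simp [pow_succ, pow_mul]

/-- The products of two vectors, which generate the even part of the exterior algebra. -/
def ιMulι (F V : Type*) [Field F] [AddCommGroup V] [Module F V] : Set (ExteriorAlgebra F V) :=
  Set.range fun x : V × V => ι F x.1 * ι F x.2

theorem ιMulι_mul_comm (x : ExteriorAlgebra F V) (hx : x ∈ ιMulι F V)
    (y : ExteriorAlgebra F V) (hy : y ∈ ιMulι F V) : x * y = y * x := by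
  obtain ⟨a, rfl⟩ := hx
  obtain ⟨b, rfl⟩ := hy
  dsimp only
  rw [mul_assoc, ι_mul_ι_mul_ι_comm a.2, ← mul_assoc, ι_mul_ι_mul_ι_comm a.1, mul_assoc]

omit [DecidableEq m] in
theorem map_ι_mul_map_ι_apply_mem (v w : Matrix m m V) (p q : m) :
    (v.map (ι F) * w.map (ι F)) p q ∈ Algebra.adjoin F (ιMulι F V) := by
  rw [mul_apply]
  exact Subalgebra.sum_mem _ fun r _ => Algebra.subset_adjoin ⟨(v p r, w r q), rfl⟩

variable [CharZero F]

theorem pow_card_of_trace_mul_trace_eq_zero_of_commute {Λ m : Type*} [Ring Λ] [Algebra F Λ]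
    [Fintype m] [DecidableEq m] (s : Set Λ) (hs : ∀ x ∈ s, ∀ y ∈ s, x * y = y * x)
    (M : Matrix m m Λ) (hMs : ∀ p q, M p q ∈ Algebra.adjoin F s)
    (hM : ∀ i j, (M ^ (i + 1)).trace * (M ^ (j + 1)).trace = 0) :
    M ^ Fintype.card m = ∑ k ∈ Finset.range (Fintype.card m),
      ((Fintype.card m - k : ℕ) : F)⁻¹ •
        (M ^ k * scalar m (M ^ (Fintype.card m - k)).trace) := by
  have := Algebra.isMulCommutative_adjoin F hs
  let : CommRing (Algebra.adjoin F s) := { mul_comm := mul_comm' }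
  let φ : Algebra.adjoin F s →ₐ[F] Λ := (Algebra.adjoin F s).val
  have hφ : Function.Injective φ := Subtype.val_injective
  let M₀ : Matrix m m (Algebra.adjoin F s) := fun p q => ⟨M p q, hMs p q⟩
  have hmap : φ.mapMatrix M₀ = M := rfl
  have htr (k : ℕ) : φ (M₀ ^ k).trace = (M ^ k).trace := by
    rw [← hmap, ← map_pow]
    exact AddMonoidHom.map_trace φ _
  have h := pow_card_of_trace_mul_trace_eq_zero (F := F) M₀ fun i j => hφ <| by
    rw [map_mul, htr, htr, hM, map_zero]
  have hsc (a : Algebra.adjoin F s) : φ.mapMatrix (scalar m a) = scalar m (φ a) := by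
    ext i j
    by_cases hij : i = j <;> simp [hij]
  have h' := congrArg φ.mapMatrix h
  simpa only [map_pow, map_sum, map_smul, map_mul, hmap, hsc, htr] using h'

theorem trace_map_ι_pow_even (v : Matrix m m V) (k : ℕ) :
    (v.map (ι F) ^ (2 * k + 2)).trace = 0 := by
  have h : (v.map (ι F) ^ (2 * k + 2)).trace = -(v.map (ι F) ^ (2 * k + 2)).trace := by
    conv_lhs => rw [pow_succ']
    conv_rhs => rw [pow_succ]
    simp only [trace, diag_apply, mul_apply, ← Finset.sum_neg_distrib]
    rw [Finset.sum_comm]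
    refine Finset.sum_congr rfl fun p _ => Finset.sum_congr rfl fun q _ => ?_
    rw [map_apply, ι_mul_map_ι_pow_apply]
    simp [pow_succ, pow_mul]
  have h2 : (2 : F) • (v.map (ι F) ^ (2 * k + 2)).trace = 0 := by
    rw [two_smul]
    nth_rw 1 [h]
    exact neg_add_cancel _
  exact (smul_eq_zero.1 h2).resolve_left two_ne_zero

/-- A form of the Amitsur–Levitzki theorem. -/
theorem map_ι_pow_two_mul_card (v : Matrix m m V) :
    v.map (ι F) ^ (2 * Fintype.card m) = 0 := by
  have htr (i : ℕ) : ((v.map (ι F) ^ 2) ^ (i + 1)).trace = 0 := by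
    rw [← pow_mul]
    exact trace_map_ι_pow_even v i
  rw [pow_mul, pow_card_of_trace_mul_trace_eq_zero_of_commute (F := F) (ιMulι F V) ιMulι_mul_comm
    (v.map (ι F) ^ 2) (by rw [pow_two]; exact map_ι_mul_map_ι_apply_mem v v) (by simp [htr])]
  refine Finset.sum_eq_zero fun k hk => ?_
  obtain ⟨j, hj⟩ := Nat.exists_eq_add_of_lt (Finset.mem_range.1 hk)
  rw [show Fintype.card m - k = j + 1 by lia, htr, map_zero, mul_zero, smul_zero]

theorem card_nsmul_scalar_ι_mul_map_ι_pow (u : V) (v : Matrix m m V) (hm : 0 < Fintype.card m) :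
    Fintype.card m • (scalar m (ι F u) * v.map (ι F) ^ (2 * Fintype.card m - 1)) =
      ∑ k ∈ Finset.range (Fintype.card m), scalar m (ι F u) * (v.map (ι F) ^ (2 * k) *
        scalar m (v.map (ι F) ^ (2 * (Fintype.card m - k) - 1)).trace) := by
  set X := v.map (ι F) with hX
  set E := scalar m (ι F u) with hE
  have hEE : E * E = 0 := by rw [hE, ← map_mul, ι_sq_zero, map_zero]
  have hEX : E * X = -(X * E) := scalar_ι_mul_map_ι u v
  have hEXE : E * X * E = 0 := by rw [hEX, neg_mul, mul_assoc, hEE, mul_zero, neg_zero]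
  set M := X ^ 2 + E * X with hM
  have hsemi : SemiconjBy E (X ^ 2) M := by
    rw [SemiconjBy, hM, add_mul, hEXE, add_zero, pow_two, ← mul_assoc, hEX, neg_mul, mul_assoc, hEX,
      mul_neg, neg_neg, mul_assoc]
  have hcomm : E * X * X ^ 2 = X ^ 2 * (E * X) := by
    have := hsemi.eq
    rw [hM, add_mul, hEXE, add_zero] at this
    rw [← mul_assoc, ← this, mul_assoc, mul_assoc, ← pow_succ, ← pow_succ']
  have hodd (k : ℕ) : E * X ^ (2 * k + 1) = X ^ (2 * k) * (E * X) := by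
    rw [pow_succ', ← mul_assoc, pow_mul]
    exact (show Commute (E * X) (X ^ 2) from hcomm).pow_right k
  have hpow (k : ℕ) : M ^ (k + 1) = X ^ (2 * k + 2) + (k + 1) • (E * X ^ (2 * k + 1)) := by
    induction k with
    | zero => simp [hM]
    | succ k ih =>
      have h1 : E * X ^ (2 * k + 1) * X ^ 2 = E * X ^ (2 * k + 3) := by
        rw [mul_assoc, ← pow_add]
      have h2 : E * X ^ (2 * k + 1) * (E * X) = 0 := by
        rw [hodd, mul_assoc, ← mul_assoc (E * X), hEXE, zero_mul, mul_zero]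
      have h3 : X ^ (2 * k + 2) * (E * X) = E * X ^ (2 * k + 3) := (hodd (k + 1)).symm
      rw [pow_succ, ih, hM, add_mul, mul_add, mul_add, smul_mul_assoc, smul_mul_assoc, h1, h2, h3,
        smul_zero, add_zero, ← pow_add, add_assoc, ← succ_nsmul']
      rfl
  have htr (k : ℕ) : (M ^ (k + 1)).trace = (k + 1) • (ι F u * (X ^ (2 * k + 1)).trace) := by
    rw [hpow, trace_add, trace_map_ι_pow_even, zero_add, trace_smul]
    congr 1
    simp [hE, trace, Finset.mul_sum]
  have hzero (i j : ℕ) : (M ^ (i + 1)).trace * (M ^ (j + 1)).trace = 0 := by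
    rw [htr, htr, smul_mul_smul_comm]
    nth_rw 1 [ι_mul_trace_map_ι_pow_odd]
    rw [neg_mul, mul_assoc, ← mul_assoc (ι F u) (ι F u), ι_sq_zero, zero_mul, mul_zero, neg_zero,
      smul_zero]
  have hmem (p q : m) : M p q ∈ Algebra.adjoin F (ιMulι F V) := by
    have hE' : E = (diagonal fun _ => u).map (ι F) := by
      rw [hE, scalar_apply, diagonal_map (map_zero _)]
    rw [hM, pow_two, hE', add_apply]
    exact add_mem (map_ι_mul_map_ι_apply_mem _ _ _ _) (map_ι_mul_map_ι_apply_mem _ _ _ _)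
  have key := pow_card_of_trace_mul_trace_eq_zero_of_commute (F := F) (ιMulι F V) ιMulι_mul_comm
    M hmem hzero
  obtain ⟨c, hc⟩ := Nat.exists_eq_add_of_lt hm
  rw [zero_add] at hc
  have hl : M ^ Fintype.card m = Fintype.card m • (E * X ^ (2 * Fintype.card m - 1)) := by
    have hz : X ^ (2 * c + 2) = 0 := by
      rw [show 2 * c + 2 = 2 * Fintype.card m by lia]
      exact map_ι_pow_two_mul_card v
    rw [hc, hpow, hz, zero_add]
    rfl
  rw [← hl, key]
  refine Finset.sum_congr rfl fun k hk => ?_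
  obtain ⟨j, hj⟩ := Nat.exists_eq_add_of_lt (Finset.mem_range.1 hk)
  rw [show Fintype.card m - k = j + 1 by lia, htr, map_nsmul, mul_smul_comm,
    ← Nat.cast_smul_eq_nsmul F (j + 1), inv_smul_smul₀ (Nat.cast_ne_zero.2 j.succ_ne_zero), map_mul,
    ← mul_assoc, ← (hsemi.pow_right k).eq, ← pow_mul, mul_assoc]
  rfl

end Exterior

section Expansion

theorem _root_.List.ofFn_comp_append {α β : Type*} {a b : ℕ} (u : α → β) (f : Fin a → α)
    (g : Fin b → α) :
    List.ofFn (u ∘ Fin.append f g) = List.ofFn (u ∘ f) ++ List.ofFn (u ∘ g) := by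
  rw [← List.map_ofFn, List.ofFn_fin_append, List.map_append, List.map_ofFn, List.map_ofFn]

variable {F Λ m J : Type*} [Field F] [Ring Λ] [Algebra F Λ] [Fintype m] [DecidableEq m]

omit [DecidableEq m] in
theorem map_smul_mul_map_smul (B C : Matrix m m F) (x y : Λ) :
    B.map (· • x) * C.map (· • y) = (B * C).map (· • (x * y)) := by
  ext p q
  simp only [mul_apply, map_apply, Finset.sum_smul, smul_mul_smul_comm]

theorem prod_ofFn_map_smul {a : ℕ} (B : Fin a → Matrix m m F) (x : Fin a → Λ) :
    (List.ofFn fun i => (B i).map (· • x i)).prod =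
      (List.ofFn B).prod.map (· • (List.ofFn x).prod) := by
  induction a with
  | zero =>
    ext p q
    by_cases h : p = q <;> simp [h]
  | succ a ih => simp [List.ofFn_succ, ih, map_smul_mul_map_smul]

variable [Fintype J] (A : J → Matrix m m F) (e : J → Λ)

theorem sum_map_smul_pow (a : ℕ) :
    (∑ k, (A k).map (· • e k)) ^ a =
      ∑ f : Fin a → J, (List.ofFn (A ∘ f)).prod.map (· • (List.ofFn (e ∘ f)).prod) := by
  have h := (MultilinearMap.mkPiAlgebraFin F a (Matrix m m Λ)).map_sum
    fun (_ : Fin a) (k : J) => (A k).map (· • e k)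
  simp only [MultilinearMap.mkPiAlgebraFin_apply, List.ofFn_const, List.prod_replicate,
    prod_ofFn_map_smul] at h
  exact h

theorem sum_map_smul_pow_apply_mul (a b : ℕ) (p q r s : m) :
    ((∑ k, (A k).map (· • e k)) ^ a) p q * ((∑ k, (A k).map (· • e k)) ^ b) r s =
      ∑ h : Fin (a + b) → J,
        (((List.ofFn (A ∘ h)).take a).prod p q * ((List.ofFn (A ∘ h)).drop a).prod r s) •
          (List.ofFn (e ∘ h)).prod := by
  rw [sum_map_smul_pow, sum_map_smul_pow, sum_apply, sum_apply, Finset.sum_mul_sum,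
    ← Fintype.sum_prod_type', ← (Fin.appendEquiv a b).sum_comp]
  refine Finset.sum_congr rfl fun ⟨f, g⟩ _ => ?_
  simp only [Fin.appendEquiv, Equiv.coe_fn_mk, List.ofFn_comp_append, List.prod_append, map_apply]
  rw [List.take_left' (List.length_ofFn), List.drop_left' (List.length_ofFn), smul_mul_smul_comm]

end Expansion

section Sign

open ExteriorAlgebra

theorem _root_.AlternatingMap.sum_smul_apply_comp {F M N : Type*} [CommRing F] [AddCommGroup M]
    [Module F M] [AddCommGroup N] [Module F N] {J : Type*} [Fintype J] [DecidableEq J]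
    (G : M [⋀^J]→ₗ[F] N) (w : J → M) (c : (J → J) → F) :
    ∑ h : J → J, c h • G (w ∘ h) =
      ∑ σ : Equiv.Perm J, (((Equiv.Perm.sign σ : ℤ) : F) * c σ) • G w := by
  symm
  refine Finset.sum_of_injOn (fun σ => σ) (fun _ _ _ _ h => DFunLike.coe_injective h)
    (by simp) ?_ ?_
  · intro h _ hh
    rw [G.map_eq_zero_of_not_injective, smul_zero]
    intro hw
    have hbij := Finite.injective_iff_bijective.1 hw.of_comp
    exact hh ⟨Equiv.ofBijective h hbij, by simp, rfl⟩
  · intro σ _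
    rw [G.map_perm, mul_comm, mul_smul, Units.smul_def, Int.cast_smul_eq_zsmul]

/-- The antisymmetrization of `c` is read off by the coefficient of the top form, a functional
on the exterior algebra. -/
theorem exists_linearMap_sum_smul_ι_mul (F : Type*) [Field F] (N : ℕ) :
    ∃ L : ExteriorAlgebra F (Fin (N + 1) → F) →ₗ[F] F, ∀ c : (Fin N → Fin N) → F,
      L (∑ h, c h • (ι F (Pi.single 0 1) *
        (List.ofFn ((fun k : Fin N => ι F (Pi.single k.succ 1)) ∘ h)).prod)) =
      ∑ σ : Equiv.Perm (Fin N), ((Equiv.Perm.sign σ : ℤ) : F) * c σ := by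
  obtain ⟨L, hL⟩ : ∃ L : ExteriorAlgebra F (Fin (N + 1) → F) →ₗ[F] F,
      ∀ v, L (ιMulti F (N + 1) v) = detRowAlternating v :=
    ⟨liftAlternating (Pi.single (N + 1) detRowAlternating), fun v => by
      rw [liftAlternating_apply_ιMulti, Pi.single_eq_same]⟩
  let G : (Fin (N + 1) → F) [⋀^Fin N]→ₗ[F] F :=
    (L ∘ₗ LinearMap.mulLeft F (ι F (Pi.single 0 1))).compAlternatingMap (ιMulti F N)
  let w : Fin N → Fin (N + 1) → F := fun k => Pi.single k.succ 1
  have hw : G w = 1 := by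
    change L (ι F (Pi.single 0 1) * ιMulti F N w) = 1
    have h := ιMulti_succ_apply (R := F) (n := N) fun i => (Pi.single i 1 : Fin (N + 1) → F)
    rw [show w = vecTail fun i => (Pi.single i 1 : Fin (N + 1) → F) from rfl, ← h, hL]
    have h1 : (fun i => Pi.single i 1) = (1 : Matrix (Fin (N + 1)) (Fin (N + 1)) F) := by
      ext i j
      simp [one_apply, Pi.single_apply, eq_comm]
    rw [h1]
    exact det_one
  refine ⟨L, fun c => ?_⟩
  have h := G.sum_smul_apply_comp w c
  simp only [hw, smul_eq_mul, mul_one] at h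
  rw [← h, map_sum]
  refine Finset.sum_congr rfl fun f _ => ?_
  rw [map_smul, smul_eq_mul]
  rfl

theorem exists_linearMap_map_ι_pow_mul {F m : Type*} [Field F] [Fintype m] [DecidableEq m] {N : ℕ}
    (A : Fin N → Matrix m m F) :
    ∃ (L : ExteriorAlgebra F (Fin (N + 1) → F) →ₗ[F] F) (u : Fin (N + 1) → F)
      (v : Matrix m m (Fin (N + 1) → F)), ∀ a b, a + b = N → ∀ p q r s,
      L (ι F u * ((v.map (ι F) ^ a) p q * (v.map (ι F) ^ b) r s)) =
        ∑ σ : Equiv.Perm (Fin N), ((Equiv.Perm.sign σ : ℤ) : F) *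
          (((List.ofFn (A ∘ σ)).take a).prod p q * ((List.ofFn (A ∘ σ)).drop a).prod r s) := by
  obtain ⟨L, hL⟩ := exists_linearMap_sum_smul_ι_mul F N
  let v : Matrix m m (Fin (N + 1) → F) := of fun p q => ∑ k, A k p q • Pi.single k.succ 1
  have hv : v.map (ι F) = ∑ k, (A k).map (· • ι F (Pi.single k.succ 1)) := by
    ext p q
    simp only [map_apply, sum_apply, v, of_apply, map_sum, map_smul]
  refine ⟨L, Pi.single 0 1, v, ?_⟩
  rintro a b rfl p q r s
  rw [hv, sum_map_smul_pow_apply_mul, Finset.mul_sum]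
  simp only [mul_smul_comm]
  rw [hL]

end Sign
end Matrix

theorem stmt13 (F : Type*) [Field F] [CharZero F] (n : ℕ) (hn : 1 ≤ n)
    (A : Fin (2 * n - 1) → Matrix (Fin n) (Fin n) F) :
    (n : F) • ∑ σ : Equiv.Perm (Fin (2 * n - 1)),
        ((Equiv.Perm.sign σ : ℤ) : F) •
          (((List.finRange (2 * n - 1)).map (fun j => A (σ j))).prod) =
      ∑ i ∈ Finset.range n, ∑ σ : Equiv.Perm (Fin (2 * n - 1)),
        ((Equiv.Perm.sign σ : ℤ) : F) •
          Matrix.trace ((((List.finRange (2 * n - 1)).drop (2 * i)).map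
              (fun j => A (σ j))).prod) •
            (((List.finRange (2 * n - 1)).take (2 * i)).map (fun j => A (σ j))).prod := by
  obtain ⟨L, u, v, hL⟩ := Matrix.exists_linearMap_map_ι_pow_mul A
  have key := Matrix.card_nsmul_scalar_ι_mul_map_ι_pow (F := F) u v (by rwa [Fintype.card_fin])
  rw [Fintype.card_fin] at key
  ext p q
  have hkey := congrArg L (congrFun₂ key p q)
  have hlist (σ : Equiv.Perm (Fin (2 * n - 1))) :
      (List.finRange (2 * n - 1)).map (fun j => A (σ j)) = List.ofFn (A ∘ σ) :=
    List.ofFn_eq_map.symm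
  simp only [Matrix.smul_apply, Matrix.sum_apply, Matrix.scalar_apply, Matrix.diagonal_mul,
    Matrix.mul_diagonal, map_sum, map_nsmul] at hkey
  simp only [List.map_drop, List.map_take, hlist, Matrix.smul_apply, Matrix.sum_apply]
  have hl := hL (2 * n - 1) 0 rfl p q p p
  simp only [pow_zero, Matrix.one_apply_eq, mul_one] at hl
  rw [hl] at hkey
  have hlen (σ : Equiv.Perm (Fin (2 * n - 1))) : (List.ofFn (A ∘ σ)).length = 2 * n - 1 :=
    List.length_ofFn
  rw [← Nat.cast_smul_eq_nsmul F] at hkey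
  convert hkey using 1
  · congr 1
    refine Finset.sum_congr rfl fun σ _ => ?_
    rw [List.take_of_length_le (hlen σ).le, List.drop_of_length_le (hlen σ).le]
    simp
  · refine Finset.sum_congr rfl fun k hk => ?_
    have hk' := Finset.mem_range.1 hk
    rw [Matrix.trace, Finset.mul_sum, Finset.mul_sum, map_sum]
    simp only [Matrix.diag_apply]
    rw [Finset.sum_congr rfl fun r _ => hL (2 * k) (2 * (n - k) - 1) (by lia) p q r r,
      Finset.sum_comm]
    refine Finset.sum_congr rfl fun σ _ => ?_
    simp only [Matrix.trace, Matrix.diag_apply, smul_eq_mul, ← Finset.mul_sum]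
    ring
end

section
/- Let K be the field of fractions of the polynomial ring C. The K-subalgebra of M_n(K) generated by the images of the generic matrices ξ_k (k ∈ ℕ) is all of M_n(K). (Consequently, the algebra of central quotients of C⟨X⟩/I_n is isomorphic to M_n(K).) -/
open scoped TensorProduct

variable (F : Type*) [Field F] [CharZero F] (n : ℕ)

/-- The square matrix whose rows are the entries of the generic matrices `ξ_{f p}`, for an
injective numbering `f` of the matrix positions, has nonzero determinant. -/
theorem det_genMat_entries_ne_zero (F : Type*) [Field F] (n : ℕ) {f : Fin n × Fin n → ℕ}
    (hf : Function.Injective f) :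
    (Matrix.of fun p q : Fin n × Fin n => genMat F n (f p) q.1 q.2).det ≠ 0 := by
  intro h
  have h1 := congrArg (evalC F n fun k => Matrix.of fun i j => if f (i, j) = k then 1 else 0) h
  rw [AlgHom.map_det, map_zero] at h1
  refine one_ne_zero (α := F) (Eq.trans ?_ h1)
  rw [← Matrix.det_one (n := Fin n × Fin n) (R := F)]
  congr 1
  ext p q
  simp [evalC, genMat, Matrix.one_apply, hf.eq_iff, eq_comm]

theorem stmt16 (F : Type*) [Field F] [CharZero F] (n : ℕ) (hn : 1 ≤ n) :
    Algebra.adjoin (FractionRing (CPoly F n))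
      (Set.range fun k : ℕ =>
        (genMat F n k).map (algebraMap (CPoly F n) (FractionRing (CPoly F n)))) = ⊤ := by
  set K := FractionRing (CPoly F n)
  set ξ : ℕ → Matrix (Fin n) (Fin n) K := fun k => (genMat F n k).map (algebraMap _ K)
  have hf : Function.Injective (Encodable.encode : Fin n × Fin n → ℕ) :=
    Encodable.encode_injective
  set D : Matrix (Fin n × Fin n) (Fin n × Fin n) K :=
    Matrix.of fun p q => ξ (Encodable.encode p) q.1 q.2
  have hdet : IsUnit D.det := by
    have hmap : D = (algebraMap (CPoly F n) K).mapMatrix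
        (Matrix.of fun p q => genMat F n (Encodable.encode p) q.1 q.2) := rfl
    rw [hmap, ← RingHom.map_det, isUnit_iff_ne_zero]
    exact (map_ne_zero_iff _ (IsFractionRing.injective (CPoly F n) K)).mpr
      (det_genMat_entries_ne_zero F n hf)
  refine eq_top_iff.mpr fun A _ => ?_
  set w : Fin n × Fin n → K := Matrix.vecMul (fun p => A p.1 p.2) D⁻¹ with hw
  have hA : A = ∑ p, w p • ξ (Encodable.encode p) := by
    ext i j
    have h : Matrix.vecMul w D (i, j) = A i j := by
      rw [hw, Matrix.vecMul_vecMul, Matrix.nonsing_inv_mul D hdet, Matrix.vecMul_one]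
    rw [← h, Matrix.sum_apply]
    rfl
  rw [hA]
  exact Subalgebra.sum_mem _ fun p _ =>
    Subalgebra.smul_mem _ (Algebra.subset_adjoin (Set.mem_range_self _)) _
end

section
/- For every F-linear subspace V of M_n(F) there exists a quasi-polynomial P ∈ C⟨X⟩ whose image under all evaluations equals V, i.e. {ev_A(P) : A is a sequence ℕ → M_n(F)} = V. -/
open scoped TensorProduct

variable (F : Type*) [Field F] [CharZero F] (n : ℕ)

/-- The square matrix whose row at `p` lists the entries of the generic matrix of index
`Encodable.encode p + 1`. -/
noncomputable def genEntryMat (F : Type*) [Field F] (n : ℕ) :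
    Matrix (Fin n × Fin n) (Fin n × Fin n) (CPoly F n) :=
  Matrix.of fun p q => MvPolynomial.X (q.1, q.2, Encodable.encode p + 1)

/-- A linear endomorphism of `M_n(F)` applied to the generic matrix `ξ_0`. -/
noncomputable def genImage (F : Type*) [Field F] (n : ℕ)
    (f : Matrix (Fin n) (Fin n) F →ₗ[F] Matrix (Fin n) (Fin n) F) :
    Fin n × Fin n → CPoly F n :=
  fun q => ∑ i, ∑ j, f (Matrix.single i j 1) q.1 q.2 • MvPolynomial.X (i, j, 0)

theorem evalC_genImage (F : Type*) [Field F] (n : ℕ)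
    (f : Matrix (Fin n) (Fin n) F →ₗ[F] Matrix (Fin n) (Fin n) F)
    (A : ℕ → Matrix (Fin n) (Fin n) F) (q : Fin n × Fin n) :
    evalC F n A (genImage F n f q) = f (A 0) q.1 q.2 := by
  have h : f (A 0) = ∑ i, ∑ j, A 0 i j • f (Matrix.single i j 1) := by
    conv_lhs => rw [Matrix.matrix_eq_sum_single (A 0)]
    simp only [map_sum, ← map_smul, Matrix.smul_single, smul_eq_mul, mul_one]
  rw [h]
  simp [genImage, evalC, Matrix.sum_apply, mul_comm]

/-- The quasi-polynomial with value `det G • f (A 0)` at `A`, where `G` is the evaluation of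
`genEntryMat`. -/
noncomputable def detSmulQPoly (F : Type*) [Field F] (n : ℕ)
    (f : Matrix (Fin n) (Fin n) F →ₗ[F] Matrix (Fin n) (Fin n) F) : QPoly F n :=
  ∑ p : Fin n × Fin n,
    Matrix.vecMul (genImage F n f) (genEntryMat F n).adjugate p •
      FreeAlgebra.ι (CPoly F n) (Encodable.encode p + 1)

theorem PhiQ_detSmulQPoly_apply (F : Type*) [Field F] (n : ℕ)
    (f : Matrix (Fin n) (Fin n) F →ₗ[F] Matrix (Fin n) (Fin n) F) (i j : Fin n) :
    PhiQ F n (detSmulQPoly F n f) i j = (genEntryMat F n).det * genImage F n f (i, j) := by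
  have h : PhiQ F n (detSmulQPoly F n f) i j =
      Matrix.vecMul (Matrix.vecMul (genImage F n f) (genEntryMat F n).adjugate)
        (genEntryMat F n) (i, j) := by
    simp only [detSmulQPoly, PhiQ, map_sum, map_smul, FreeAlgebra.lift_ι_apply,
      Matrix.sum_apply, Matrix.smul_apply, smul_eq_mul]
    rfl
  rw [h, Matrix.vecMul_vecMul, Matrix.adjugate_mul, Matrix.vecMul_smul, Matrix.vecMul_one]
  rfl

theorem evalQ_detSmulQPoly (F : Type*) [Field F] (n : ℕ)
    (f : Matrix (Fin n) (Fin n) F →ₗ[F] Matrix (Fin n) (Fin n) F)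
    (A : ℕ → Matrix (Fin n) (Fin n) F) :
    evalQ F n A (detSmulQPoly F n f) = evalC F n A (genEntryMat F n).det • f (A 0) := by
  ext i j
  change evalC F n A (PhiQ F n (detSmulQPoly F n f) i j) = _
  rw [PhiQ_detSmulQPoly_apply, map_mul, evalC_genImage]
  rfl

/-- A sequence starting with a prescribed matrix and continuing with the matrix units. -/
def unitSeq (F : Type*) [Field F] (n : ℕ) (v : Matrix (Fin n) (Fin n) F) :
    ℕ → Matrix (Fin n) (Fin n) F
  | 0 => v
  | k + 1 => ((Encodable.decode k : Option (Fin n × Fin n)).map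
      fun p => Matrix.single p.1 p.2 1).getD 0

theorem evalC_unitSeq_det (F : Type*) [Field F] (n : ℕ) (v : Matrix (Fin n) (Fin n) F) :
    evalC F n (unitSeq F n v) (genEntryMat F n).det = 1 := by
  have h : (evalC F n (unitSeq F n v)).mapMatrix (genEntryMat F n) = 1 := by
    ext p q
    simp [genEntryMat, evalC, unitSeq, Matrix.single_apply, Matrix.one_apply, Prod.ext_iff,
      -Encodable.decode_prod_val]
  rw [AlgHom.map_det, h, Matrix.det_one]

theorem stmt17 (F : Type*) [Field F] [CharZero F] (n : ℕ) (hn : 1 ≤ n)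
    (V : Submodule F (Matrix (Fin n) (Fin n) F)) :
    ∃ P : QPoly F n,
      Set.range (fun A : ℕ → Matrix (Fin n) (Fin n) F => evalQ F n A P) =
        (V : Set (Matrix (Fin n) (Fin n) F)) := by
  obtain ⟨g, hg⟩ := V.subtype.exists_leftInverse_of_injective V.ker_subtype
  refine ⟨detSmulQPoly F n (V.subtype ∘ₗ g), Set.Subset.antisymm ?_ fun v hv => ?_⟩
  · rintro _ ⟨A, rfl⟩
    simp only [evalQ_detSmulQPoly]
    exact V.smul_mem _ (g (A 0)).2
  · refine ⟨unitSeq F n v, ?_⟩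
    have hgv : g v = ⟨v, hv⟩ := LinearMap.congr_fun hg ⟨v, hv⟩
    simp [evalQ_detSmulQPoly, evalC_unitSeq_det, unitSeq, hgv]
end

section
/- Let n = 2 and consider the quasi-polynomials P_1 = x_{12}^{(2)}·x_1 − x_{12}^{(1)}·x_2 + x_{12}^{(1)}x_{22}^{(2)} − x_{22}^{(1)}x_{12}^{(2)} and P_2 = x_{12}^{(2)}·x_1 − x_{12}^{(1)}·x_2 + x_{12}^{(1)}x_{11}^{(2)} − x_{11}^{(1)}x_{12}^{(2)} in C⟨X⟩. Then neither P_1 nor P_2 is a quasi-identity of M_2, but the product P_1·P_2 is a quasi-identity of M_2. (In particular, the quotient C⟨X⟩/I_2 is not an integral domain.) -/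
open scoped TensorProduct

variable (F : Type*) [Field F] [CharZero F] (n : ℕ)

/-- `P_1 = x_{12}^{(2)} x_1 − x_{12}^{(1)} x_2 + x_{12}^{(1)} x_{22}^{(2)} − x_{22}^{(1)} x_{12}^{(2)}`.
(Here the noncommuting variables `x_1, x_2` are indexed by `0, 1` and
superscripts `(1), (2)` correspond to `k = 0, 1`; row/column indices `1, 2`
correspond to `0, 1`.) -/
noncomputable def P1ex : QPoly F 2 :=
  algebraMap (CPoly F 2) (QPoly F 2) (MvPolynomial.X (0, 1, 1)) * FreeAlgebra.ι (CPoly F 2) 0 -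
  algebraMap (CPoly F 2) (QPoly F 2) (MvPolynomial.X (0, 1, 0)) * FreeAlgebra.ι (CPoly F 2) 1 +
  algebraMap (CPoly F 2) (QPoly F 2)
    (MvPolynomial.X (0, 1, 0) * MvPolynomial.X (1, 1, 1)) -
  algebraMap (CPoly F 2) (QPoly F 2)
    (MvPolynomial.X (1, 1, 0) * MvPolynomial.X (0, 1, 1))

/-- `P_2 = x_{12}^{(2)} x_1 − x_{12}^{(1)} x_2 + x_{12}^{(1)} x_{11}^{(2)} − x_{11}^{(1)} x_{12}^{(2)}`. -/
noncomputable def P2ex : QPoly F 2 :=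
  algebraMap (CPoly F 2) (QPoly F 2) (MvPolynomial.X (0, 1, 1)) * FreeAlgebra.ι (CPoly F 2) 0 -
  algebraMap (CPoly F 2) (QPoly F 2) (MvPolynomial.X (0, 1, 0)) * FreeAlgebra.ι (CPoly F 2) 1 +
  algebraMap (CPoly F 2) (QPoly F 2)
    (MvPolynomial.X (0, 1, 0) * MvPolynomial.X (0, 0, 1)) -
  algebraMap (CPoly F 2) (QPoly F 2)
    (MvPolynomial.X (0, 0, 0) * MvPolynomial.X (0, 1, 1))

theorem evalQ_ι (A : ℕ → Matrix (Fin n) (Fin n) F) (k : ℕ) :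
    evalQ F n A (FreeAlgebra.ι (CPoly F n) k) = A k := by
  ext i j
  simp [evalQ, PhiQ, genMat, evalC]

theorem evalQ_algebraMap (A : ℕ → Matrix (Fin n) (Fin n) F) (c : CPoly F n) :
    evalQ F n A (algebraMap (CPoly F n) (QPoly F n) c) =
      algebraMap F (Matrix (Fin n) (Fin n) F) (evalC F n A c) := by
  simp only [evalQ, AlgHom.comp_apply, AlgHom.restrictScalars_apply, AlgHom.commutes]
  ext i j
  by_cases h : i = j <;> simp [Matrix.algebraMap_matrix_apply, h]

theorem evalC_X (A : ℕ → Matrix (Fin n) (Fin n) F) (i j : Fin n) (k : ℕ) :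
    evalC F n A (MvPolynomial.X (i, j, k)) = A k i j := by
  simp [evalC]

theorem evalQ_P1ex (A : ℕ → Matrix (Fin 2) (Fin 2) F) :
    evalQ F 2 A (P1ex F) =
      !![A 1 0 1 * A 0 0 0 - A 0 0 1 * A 1 0 0 + A 0 0 1 * A 1 1 1 - A 0 1 1 * A 1 0 1, 0;
        A 1 0 1 * A 0 1 0 - A 0 0 1 * A 1 1 0, 0] := by
  simp only [P1ex, map_add, map_sub, map_mul, evalQ_ι, evalQ_algebraMap, evalC_X]
  ext i j
  fin_cases i <;> fin_cases j <;>
    simp [Matrix.algebraMap_eq_diagonal, Matrix.mul_apply, Fin.sum_univ_two] <;> ring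

theorem evalQ_P2ex (A : ℕ → Matrix (Fin 2) (Fin 2) F) :
    evalQ F 2 A (P2ex F) =
      !![0, 0; A 1 0 1 * A 0 1 0 - A 0 0 1 * A 1 1 0,
        A 1 0 1 * A 0 1 1 - A 0 0 1 * A 1 1 1 + A 0 0 1 * A 1 0 0 - A 0 0 0 * A 1 0 1] := by
  simp only [P2ex, map_add, map_sub, map_mul, evalQ_ι, evalQ_algebraMap, evalC_X]
  ext i j
  fin_cases i <;> fin_cases j <;>
    simp [Matrix.algebraMap_eq_diagonal, Matrix.mul_apply, Fin.sum_univ_two] <;> ring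

theorem stmt18 (F : Type*) [Field F] [CharZero F] :
    ¬ IsQuasiIdentity F 2 (P1ex F) ∧ ¬ IsQuasiIdentity F 2 (P2ex F) ∧
      IsQuasiIdentity F 2 (P1ex F * P2ex F) := by
  refine ⟨fun h => ?_, fun h => ?_, fun A => ?_⟩
  · have h₁ := congrFun (congrFun (h fun k => if k = 0 then !![0, 0; 1, 0] else !![0, 1; 0, 0]) 1) 0
    simp [evalQ_P1ex] at h₁
  · have h₁ := congrFun (congrFun (h fun k => if k = 0 then !![0, 0; 1, 0] else !![0, 1; 0, 0]) 1) 0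
    simp [evalQ_P2ex] at h₁
  · rw [map_mul, evalQ_P1ex, evalQ_P2ex]
    ext i j
    fin_cases i <;> fin_cases j <;> simp [Matrix.mul_apply, Fin.sum_univ_two]
end

section
/- For every central polynomial c of M_n, the quasi-polynomial c − (1/n)·tr(Φ(c)) ∈ C⟨X⟩ (where tr(Φ(c)) ∈ C is regarded as a central coefficient) is a quasi-identity of M_n and lies in the T-ideal of C⟨X⟩ generated by the Cayley–Hamilton quasi-polynomial q_n. -/
open scoped TensorProduct

variable (F : Type*) [Field F] [CharZero F] (n : ℕ)

open Equiv in
/-- The product over the cycles of `π` of the traces of the corresponding products of the `B k`,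
written as a sum over index assignments. -/
def permTrace {α ι K : Type*} [Fintype α] [Fintype ι] [DecidableEq α] [CommRing K] (π : Perm α)
    (B : α → Matrix ι ι K) : K :=
  ∑ i : α → ι, ∏ k, B k (i k) (i (π k))

/-- The permutations that fix every point outside `S`. -/
def permsOn {α : Type*} [Fintype α] [DecidableEq α] (S : Finset α) : Finset (Equiv.Perm α) :=
  Finset.univ.filter fun τ => ∀ y ∉ S, τ y = y

section PermTrace

open Equiv Finset

variable {α ι K : Type*} [Fintype α] [DecidableEq α] [Fintype ι] [DecidableEq ι] [CommRing K]

theorem mem_permsOn {S : Finset α} {τ : Perm α} : τ ∈ permsOn S ↔ ∀ y ∉ S, τ y = y := by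
  simp [permsOn]

theorem mul_mem_permsOn {S : Finset α} {σ τ : Perm α} (hσ : σ ∈ permsOn S) (hτ : τ ∈ permsOn S) :
    σ * τ ∈ permsOn S := by
  rw [mem_permsOn] at *
  intro y hy
  rw [Perm.mul_apply, hτ y hy, hσ y hy]

theorem inv_mem_permsOn {S : Finset α} {σ : Perm α} (hσ : σ ∈ permsOn S) :
    σ⁻¹ ∈ permsOn S := by
  rw [mem_permsOn] at *
  intro y hy
  rw [Perm.inv_eq_iff_eq, hσ y hy]

theorem swap_mem_permsOn {S : Finset α} {x y : α} (hx : x ∈ S) (hy : y ∈ S) :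
    swap x y ∈ permsOn S := by
  rw [mem_permsOn]
  intro z hz
  exact swap_apply_of_ne_of_ne (fun h => hz (h ▸ hx)) (fun h => hz (h ▸ hy))

theorem sum_permsOn_mul_left {M : Type*} [AddCommMonoid M] {S : Finset α} {σ : Perm α}
    (hσ : σ ∈ permsOn S) (f : Perm α → M) :
    ∑ τ ∈ permsOn S, f (σ * τ) = ∑ τ ∈ permsOn S, f τ := by
  refine Finset.sum_bij' (fun τ _ => σ * τ) (fun τ _ => σ⁻¹ * τ)
    (fun τ h => mul_mem_permsOn hσ h) (fun τ h => mul_mem_permsOn (inv_mem_permsOn hσ) h)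
    ?_ ?_ ?_ <;> simp

/-- A sum over `permsOn S` that is invariant under a transposition vanishes when signed. -/
theorem sum_sign_eq_zero_of_swap {M : Type*} [AddCommGroup M] [IsAddTorsionFree M]
    {S : Finset α} {x y : α} (hx : x ∈ S) (hy : y ∈ S) (hxy : x ≠ y) (f : Perm α → M)
    (hf : ∀ τ, f (swap x y * τ) = f τ) :
    ∑ τ ∈ permsOn S, ((Perm.sign τ : ℤˣ) : ℤ) • f τ = 0 := by
  have h := sum_permsOn_mul_left (swap_mem_permsOn hx hy)
    (fun τ => ((Perm.sign τ : ℤˣ) : ℤ) • f τ)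
  simp only [hf, Perm.sign_mul, Perm.sign_swap hxy, Units.val_neg, neg_mul, one_mul, neg_smul,
    Finset.sum_neg_distrib] at h
  exact self_eq_neg.mp h.symm

omit [DecidableEq ι] in
theorem permTrace_conj (g π : Perm α) (B : α → Matrix ι ι K) :
    permTrace (g * π * g⁻¹) B = permTrace π (fun k => B (g k)) := by
  unfold permTrace
  refine Fintype.sum_equiv (Equiv.arrowCongr g.symm (Equiv.refl ι)) _ _ fun i => ?_
  refine Fintype.prod_equiv g.symm _ _ fun k => ?_
  simp

/-- Removing a non-fixed point `k` from its cycle, multiplying `B k` into its successor. -/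
theorem permTrace_merge (π : Perm α) (k : α) (hk : π k ≠ k) (B : α → Matrix ι ι K) :
    (Fintype.card ι : K) * permTrace π B =
      permTrace (swap k (π k) * π)
        (Function.update (Function.update B (π k) (B k * B (π k))) k 1) := by
  set l := π k with hl
  have key : ∀ i : α → ι, ∏ y, (Function.update (Function.update B l (B k * B l)) k 1) y (i y)
        (i ((swap k l * π) y)) =
      ∑ z, ∏ y, B y (Function.update (Function.update i k (i l)) l z y)
        (Function.update (Function.update i k (i l)) l z (π y)) := by
    intro i
    have hlmem : l ∈ univ.erase k := by simp [hk]
    rw [← mul_prod_erase univ _ (mem_univ k), ← mul_prod_erase _ _ hlmem]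
    simp only [Function.update_self, Perm.mul_apply, ← hl, swap_apply_right, Matrix.one_apply_eq,
      Function.update_of_ne hk, one_mul, Matrix.mul_apply, sum_mul]
    refine sum_congr rfl fun z _ => ?_
    rw [← mul_prod_erase univ _ (mem_univ k), ← mul_prod_erase _ _ hlmem, ← mul_assoc]
    simp only [Function.update_self, ← hl, Function.update_of_ne hk.symm]
    have hoff : ∀ y, y ≠ k → i (swap k l (π y)) =
        Function.update (Function.update i k (i l)) l z (π y) := by
      intro y hy
      have h1 : π y ≠ l := fun h => hy (π.injective h)
      rw [Function.update_of_ne h1]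
      by_cases h2 : π y = k
      · rw [h2, swap_apply_left, Function.update_self]
      · rw [swap_apply_of_ne_of_ne h2 h1, Function.update_of_ne h2]
    rw [hoff l hk]
    congr 1
    refine prod_congr rfl fun y hy => ?_
    simp only [mem_erase, mem_univ, and_true] at hy
    rw [Function.update_of_ne hy.2, Function.update_of_ne hy.1, Function.update_of_ne hy.1,
      Function.update_of_ne hy.2, hoff y hy.2]
  let e : (α → ι) × ι ≃ (α → ι) × ι :=
    { toFun := fun p => (Function.update (Function.update p.1 k (p.1 l)) l p.2, p.1 k)
      invFun := fun p => (Function.update (Function.update p.1 l (p.1 k)) k p.2, p.1 l)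
      left_inv := by
        rintro ⟨i, z⟩
        simp only [Prod.mk.injEq, Function.update_self, and_true]
        ext y
        by_cases hy : y = k
        · subst hy; simp
        by_cases hy' : y = l
        · simp [hy', hk, hk.symm]
        · simp [hy, hy']
      right_inv := by
        rintro ⟨i, z⟩
        simp only [Prod.mk.injEq, Function.update_self, and_true]
        ext y
        by_cases hy' : y = l
        · simp [hy']
        by_cases hy : y = k
        · subst hy; simp [hk, hk.symm]
        · simp [hy, hy'] }
  calc (Fintype.card ι : K) * permTrace π B
      = ∑ p : (α → ι) × ι, ∏ y, B y (p.1 y) (p.1 (π y)) := by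
        rw [Fintype.sum_prod_type]
        simp [permTrace, Finset.mul_sum]
    _ = ∑ p : (α → ι) × ι, ∏ y, B y ((e p).1 y) ((e p).1 (π y)) :=
        (Equiv.sum_comp e (fun p : (α → ι) × ι => ∏ y, B y (p.1 y) (p.1 (π y)))).symm
    _ = _ := by
        rw [Fintype.sum_prod_type, permTrace]
        exact sum_congr rfl fun i _ => (key i).symm

omit [DecidableEq ι] in
theorem sum_sign_permTrace_eq_zero [IsAddTorsionFree K] (S : Finset α)
    (hS : Fintype.card ι < S.card) (σ : Perm α) (B : α → Matrix ι ι K) :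
    ∑ τ ∈ permsOn S, ((Perm.sign τ : ℤˣ) : ℤ) • permTrace (σ * τ) B = 0 := by
  simp only [permTrace, smul_sum]
  rw [sum_comm]
  refine sum_eq_zero fun i _ => ?_
  obtain ⟨x, hx, y, hy, hxy, h⟩ : ∃ x ∈ S, ∃ y ∈ S, x ≠ y ∧ i (σ x) = i (σ y) :=
    exists_ne_map_eq_of_card_lt_of_maps_to (t := univ) (by simpa using hS) (by simp [Set.MapsTo])
  refine sum_sign_eq_zero_of_swap hx hy hxy _ fun τ => prod_congr rfl fun k _ => ?_
  have : ∀ z, i (σ (swap x y z)) = i (σ z) := by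
    intro z
    rcases eq_or_ne z x with rfl | hzx
    · rw [swap_apply_left, h]
    rcases eq_or_ne z y with rfl | hzy
    · rw [swap_apply_right, h]
    · rw [swap_apply_of_ne_of_ne hzx hzy]
  simp only [Perm.mul_apply, this]

theorem permTrace_single (π : Perm α) (u v : α → ι) :
    permTrace π (fun k => Matrix.single (u k) (v k) (1 : K)) =
      if ∀ k, u (π k) = v k then 1 else 0 := by
  unfold permTrace
  rw [sum_eq_single u]
  · simp only [Matrix.single_apply, true_and, prod_boole, mem_univ, true_implies]
    simp only [eq_comm]
  · intro i _ hi
    obtain ⟨k, hk⟩ := Function.ne_iff.mp hi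
    exact prod_eq_zero (mem_univ k) (by simp [hk.symm])
  · simp

end PermTrace

section PermTraceDet

open Equiv Finset

variable {α ι K : Type*} [Fintype α] [DecidableEq α] [Fintype ι] [DecidableEq ι] [CommRing K]

theorem sum_permsOn_eq {M : Type*} [AddCommMonoid M] (S : Finset α) (f : Perm α → M) :
    ∑ τ ∈ permsOn S, f τ = ∑ τ : Perm S, f (Perm.ofSubtype τ) := by
  symm
  refine Finset.sum_bij (fun τ _ => Perm.ofSubtype τ) ?_ ?_ ?_ ?_
  · intro τ _
    rw [mem_permsOn]
    intro y hy
    exact Perm.ofSubtype_apply_of_not_mem τ hy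
  · intro τ _ τ' _ h
    exact Perm.ofSubtype_injective h
  · intro τ hτ
    rw [mem_permsOn] at hτ
    have h1 : ∀ x, x ∈ S ↔ τ x ∈ S := by
      intro x
      refine ⟨fun hx => ?_, fun hx => ?_⟩
      · by_contra h
        exact h (by rw [τ.injective (hτ _ h)]; exact hx)
      · by_contra h
        rw [hτ x h] at hx
        exact h hx
    refine ⟨τ.subtypePerm fun x => (h1 x).symm, mem_univ _, ?_⟩
    refine Perm.ofSubtype_subtypePerm _ fun x hx => ?_
    by_contra h
    exact hx (hτ x h)
  · simp

omit [DecidableEq ι] in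
theorem permTrace_ofSubtype (S : Finset α) (τ : Perm S) (B : α → Matrix ι ι K) :
    permTrace (Perm.ofSubtype τ) B =
      (∏ k ∈ Sᶜ, (B k).trace) * permTrace τ (fun k => B k) := by
  unfold permTrace
  rw [Fintype.sum_equiv (Equiv.piEquivPiSubtypeProd (· ∈ S) (fun _ => ι)) _
    (fun p => (∏ k : {k // k ∉ S}, B k (p.2 k) (p.2 k)) * ∏ k : S, B k (p.1 k) (p.1 (τ k)))]
  · rw [Fintype.sum_prod_type_right]
    simp only [← Finset.mul_sum]
    rw [← Finset.sum_mul]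
    congr 1
    have : ∏ k ∈ Sᶜ, (B k).trace = ∏ k : {k // k ∉ S}, (B k).trace :=
      Finset.prod_subtype _ (by simp) _
    rw [this]
    simp only [Matrix.trace, Matrix.diag]
    rw [Finset.prod_univ_sum]
    simp
  · intro i
    rw [← Finset.prod_mul_prod_compl S, mul_comm, ← Finset.prod_coe_sort S,
      Finset.prod_subtype Sᶜ (p := (· ∉ S)) (by simp)]
    congr 1
    · refine prod_congr rfl fun k _ => ?_
      rw [Perm.ofSubtype_apply_of_not_mem τ k.2]
      rfl
    · refine prod_congr rfl fun k _ => ?_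
      rw [Perm.ofSubtype_apply_coe]
      rfl

omit [DecidableEq ι] in
theorem sum_sign_permTrace_eq_sum_det (M : Matrix ι ι K) :
    ∑ τ : Perm α, ((Perm.sign τ : ℤˣ) : ℤ) • permTrace τ (fun _ => M) =
      ∑ i : α → ι, (M.submatrix i i).det := by
  simp only [permTrace, smul_sum]
  rw [sum_comm]
  refine sum_congr rfl fun i _ => ?_
  rw [← Matrix.det_transpose, Matrix.det_apply]
  exact sum_congr rfl fun τ _ => by simp [Units.smul_def]

theorem sum_det_submatrix (M : Matrix ι ι K) :
    ∑ i : α → ι, (M.submatrix i i).det =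
      ((Fintype.card α).factorial : K) * ∑ U ∈ univ.powersetCard (Fintype.card α),
        (M.submatrix (Subtype.val : U → ι) (Subtype.val : U → ι)).det := by
  have h1 : ∑ i : α → ι, (M.submatrix i i).det =
      ∑ i : α → ι with Function.Injective i, (M.submatrix i i).det := by
    symm
    refine sum_subset (filter_subset _ _) fun i _ hi => ?_
    replace hi : ¬ Function.Injective i := by simpa using hi
    simp only [Function.Injective, not_forall] at hi
    obtain ⟨x, y, hxy, hne⟩ := hi
    exact Matrix.det_zero_of_row_eq hne (by ext z; simp [hxy])
  rw [h1, ← sum_fiberwise_of_maps_to (t := univ.powersetCard (Fintype.card α))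
    (g := fun i => univ.image i), mul_sum]
  · refine sum_congr rfl fun U hU => ?_
    rw [mem_powersetCard] at hU
    have hcard : Fintype.card α = Fintype.card U := by simp [hU.2]
    have h2 : ∑ e : α ≃ U, (M.submatrix (fun k => (e k : ι)) (fun k => (e k : ι))).det =
        ((Fintype.card α).factorial : K) *
          (M.submatrix (Subtype.val : U → ι) (Subtype.val : U → ι)).det := by
      rw [← Fintype.card_equiv (Fintype.equivOfCardEq hcard), ← nsmul_eq_mul]
      refine sum_eq_card_nsmul fun e _ => ?_
      exact Matrix.det_submatrix_equiv_self e (M.submatrix Subtype.val Subtype.val)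
    rw [← h2]
    symm
    refine sum_bij (fun e _ k => (e k : ι)) ?_ ?_ ?_ ?_
    · intro e _
      simp only [mem_filter, mem_univ, true_and]
      refine ⟨Subtype.val_injective.comp e.injective, ?_⟩
      ext x
      simp only [mem_image, mem_univ, true_and]
      refine ⟨?_, fun hx => ⟨e.symm ⟨x, hx⟩, by simp⟩⟩
      rintro ⟨k, rfl⟩
      exact (e k).2
    · intro e _ e' _ h
      ext k
      exact congrFun h k
    · intro i hi
      simp only [mem_filter, mem_univ, true_and] at hi
      have hmem : ∀ k, i k ∈ U := fun k => hi.2 ▸ mem_image_of_mem i (mem_univ k)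
      refine ⟨Equiv.ofBijective (fun k => ⟨i k, hmem k⟩) ?_, mem_univ _, rfl⟩
      rw [Fintype.bijective_iff_injective_and_card]
      exact ⟨fun x y h => hi.1 (congrArg Subtype.val h), hcard⟩
    · intro e _
      rfl
  · intro i hi
    simp only [mem_filter, mem_univ, true_and] at hi
    rw [mem_powersetCard]
    exact ⟨subset_univ _, card_image_of_injective _ hi⟩

/-- The signed sum of the `permTrace`s over the permutations of `S` is, up to sign, a multiple of
a coefficient of the characteristic polynomial. -/
theorem sum_sign_permTrace_const (S : Finset α) (hS : S.card ≤ Fintype.card ι)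
    (M : Matrix ι ι K) (B : α → Matrix ι ι K) (hB : ∀ k ∈ S, B k = M) :
    ∑ τ ∈ permsOn S, ((Perm.sign τ : ℤˣ) : ℤ) • permTrace τ B =
      (∏ k ∈ Sᶜ, (B k).trace) * ((S.card.factorial : K) *
        ((-1) ^ S.card * M.charpoly.coeff (Fintype.card ι - S.card))) := by
  rw [sum_permsOn_eq]
  simp only [Perm.sign_ofSubtype, permTrace_ofSubtype, ← mul_smul_comm]
  rw [← mul_sum]
  have : (fun k : S => B k) = fun _ => M := funext fun k => hB k k.2
  rw [this, sum_sign_permTrace_eq_sum_det, sum_det_submatrix, Fintype.card_coe,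
    Matrix.charpoly_coeff_eq_sum_minors M _ hS, ← mul_assoc ((-1) ^ S.card), ← mul_pow]
  simp

/-- For the standard cycle, `permTrace` is the trace of the product. -/
theorem permTrace_finRotate {m : ℕ} (B : Fin (m + 1) → Matrix ι ι K) :
    permTrace (finRotate (m + 1)) B = (List.ofFn B).prod.trace := by
  have key : ∀ (m : ℕ) (B : Fin (m + 1) → Matrix ι ι K) (x y : ι), (List.ofFn B).prod x y =
      ∑ i : Fin m → ι, ∏ k : Fin (m + 1), B k (Fin.cons (α := fun _ => ι) x i k)
        (Fin.snoc (α := fun _ => ι) i y k) := by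
    intro m
    induction m with
    | zero => intro B x y; simp [Fin.snoc]
    | succ m ih =>
      intro B x y
      rw [List.ofFn_succ, List.prod_cons, Matrix.mul_apply,
        ← (Fin.consEquiv (fun _ : Fin (m + 1) => ι)).sum_comp, Fintype.sum_prod_type]
      refine sum_congr rfl fun z _ => ?_
      rw [ih, mul_sum]
      refine sum_congr rfl fun i _ => ?_
      rw [Fin.prod_univ_succ (n := m + 1)]
      simp only [Fin.consEquiv, Equiv.coe_fn_mk, Fin.cons_zero, Fin.cons_succ,
        ← Fin.cons_snoc_eq_snoc_cons]
  unfold permTrace Matrix.trace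
  rw [← (Fin.consEquiv (fun _ : Fin (m + 1) => ι)).sum_comp, Fintype.sum_prod_type]
  refine sum_congr rfl fun x _ => ?_
  rw [Matrix.diag, key]
  refine sum_congr rfl fun i _ => prod_congr rfl fun k _ => ?_
  congr 1
  induction k using Fin.lastCases with
  | last => simp [Fin.consEquiv]
  | cast k => simp [Fin.consEquiv]

end PermTraceDet

open Equiv in
/-- `CycleWalk π a x L` says that `L` lists the points met when iterating `π` from `x` (excluded)
until the first visit to `a` (included). -/
inductive CycleWalk {α : Type*} (π : Perm α) (a : α) : α → List α → Prop
  | last {x : α} (h : π x = a) : CycleWalk π a x [a]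
  | step {x : α} {L : List α} (h : π x ≠ a) (hL : CycleWalk π a (π x) L) :
      CycleWalk π a x (π x :: L)

namespace CycleWalk

open Equiv

variable {α : Type*} {π : Perm α} {a x : α} {L : List α}

theorem unique (h : CycleWalk π a x L) : ∀ {L'}, CycleWalk π a x L' → L = L' := by
  induction h with
  | last h => rintro L' (h' | ⟨h', -⟩) <;> [rfl; exact absurd h h']
  | step h _ ih => rintro L' (h' | ⟨-, hL⟩) <;> [exact absurd h' h; rw [ih hL]]

theorem mem_last (h : CycleWalk π a x L) : a ∈ L := by
  induction h with
  | last h => simp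
  | step h _ ih => simp [ih]

theorem exists_suffix (h : CycleWalk π a x L) {y : α} (hy : y ∈ L) (hya : y ≠ a) :
    ∃ L', CycleWalk π a y L' ∧ L'.length < L.length := by
  induction h with
  | last h => exact absurd (by simpa using hy) hya
  | step h hL ih =>
    rcases List.mem_cons.mp hy with rfl | hy
    · exact ⟨_, hL, by simp⟩
    · obtain ⟨L', h1, h2⟩ := ih hy
      exact ⟨L', h1, h2.trans (by simp)⟩

theorem nodup (h : CycleWalk π a x L) : L.Nodup := by
  induction h with
  | last h => simp
  | step h hL ih =>
    refine List.nodup_cons.mpr ⟨fun hmem => ?_, ih⟩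
    obtain ⟨L', h1, h2⟩ := hL.exists_suffix hmem h
    exact h2.ne (congrArg List.length (h1.unique hL))

theorem apply_mem (h : CycleWalk π a x L) {y : α} (hy : y ∈ L) (hya : y ≠ a) : π y ∈ L := by
  induction h with
  | last h => exact absurd (by simpa using hy) hya
  | step h hL ih =>
    rcases List.mem_cons.mp hy with rfl | hy
    · rcases hL with h' | ⟨h', hL'⟩
      · simp [h']
      · simp
    · exact List.mem_cons_of_mem _ (ih hy)

theorem mem_of_apply_mem (h : CycleWalk π a x L) {y : α} (hy : π y ∈ L) (hyx : y ≠ x) :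
    y ∈ L := by
  induction h with
  | last h => exact absurd (π.injective ((List.mem_singleton.mp hy).trans h.symm)) hyx
  | @step x L h hL ih =>
    rcases List.mem_cons.mp hy with hy | hy
    · exact absurd (π.injective hy) hyx
    · by_cases hyx' : y = π x
      · simp [hyx']
      · exact List.mem_cons_of_mem _ (ih hy hyx')

theorem exists_of_iterate {a : α} (m : ℕ) : ∀ {x : α}, (π ^ (m + 1)) x = a →
    ∃ L, CycleWalk π a x L := by
  induction m with
  | zero => exact fun h => ⟨_, .last (by simpa using h)⟩
  | succ m ih =>
    intro x h
    by_cases hx : π x = a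
    · exact ⟨_, .last hx⟩
    · obtain ⟨L, hL⟩ := ih (x := π x) (by rw [← h, pow_succ π (m + 1), Perm.mul_apply])
      exact ⟨_, .step hx hL⟩

theorem exists_walk [Finite α] (π : Perm α) (a : α) : ∃ L, CycleWalk π a a L := by
  refine exists_of_iterate (orderOf π - 1) ?_
  rw [Nat.sub_add_cancel (orderOf_pos π), pow_orderOf_eq_one, Perm.one_apply]

theorem conj (h : CycleWalk π a x L) (g : Perm α) :
    CycleWalk (g * π * g⁻¹) (g a) (g x) (L.map g) := by
  induction h with
  | last h => exact .last (by simp [h])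
  | @step x L h hL ih =>
    have h1 : (g * π * g⁻¹) (g x) = g (π x) := by simp
    rw [List.map_cons, ← h1]
    exact .step (by rw [h1]; exact fun h' => h (g.injective h')) (by rw [h1]; exact ih)

variable [DecidableEq α]

/-- Removing `k` from its cycle deletes it from walks. -/
theorem merge {k : α} (hka : k ≠ a) (hk : π k ≠ k) (h : CycleWalk π a x L) (hx : x ≠ k) :
    CycleWalk (swap k (π k) * π) a x (L.filter (· ≠ k)) := by
  have key : (x ≠ k → CycleWalk (swap k (π k) * π) a x (L.filter (· ≠ k))) ∧
      (x = k → (π k = a ∧ L = [a]) ∨ (π k ≠ a ∧ ∃ L', L = π k :: L' ∧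
        CycleWalk (swap k (π k) * π) a (π k) (L'.filter (· ≠ k)))) := by
    clear hx
    induction h with
    | @last x h =>
      refine ⟨fun hx => ?_, ?_⟩
      · have h1 : (swap k (π k) * π) x = a := by
          rw [Perm.mul_apply, h, swap_apply_of_ne_of_ne hka.symm]
          rw [← h]
          exact fun h' => hx (π.injective h')
        simpa [hka.symm] using CycleWalk.last h1
      · rintro rfl
        exact .inl ⟨h, rfl⟩
    | @step x L h hL ih =>
      refine ⟨fun hx => ?_, ?_⟩
      · by_cases hy : π x = k
        · have h1 : (swap k (π k) * π) x = π k := by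
            rw [Perm.mul_apply, hy, swap_apply_left]
          rcases ih.2 hy with ⟨h2, rfl⟩ | ⟨h2, L', rfl, h3⟩
          · simpa [hy, hka.symm] using CycleWalk.last (h1.trans h2)
          · have := CycleWalk.step (π := swap k (π k) * π) (by rw [h1]; exact h2)
              (by rw [h1]; exact h3)
            simpa [hy, hk, h1] using this
        · have h1 : (swap k (π k) * π) x = π x := by
            rw [Perm.mul_apply, swap_apply_of_ne_of_ne hy fun h' => hx (π.injective h')]
          have := CycleWalk.step (π := swap k (π k) * π) (by rw [h1]; exact h)
            (by rw [h1]; exact ih.1 hy)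
          simpa [hy, h1] using this
      · rintro rfl
        exact .inr ⟨h, L, rfl, ih.1 hk⟩
  exact key.1 hx

theorem merge_prod {R : Type*} [Monoid R] {k : α} (hka : k ≠ a) (hk : π k ≠ k)
    (h : CycleWalk π a x L) (hx : x ≠ k) (H : α → R) :
    ((L.filter (· ≠ k)).map
      (Function.update (Function.update H (π k) (H k * H (π k))) k 1)).prod = (L.map H).prod := by
  set H' := Function.update (Function.update H (π k) (H k * H (π k))) k 1 with hH'
  have hl : H' (π k) = H k * H (π k) := by simp [hH', hk]
  have hne : ∀ y, y ≠ k → y ≠ π k → H' y = H y := fun y h1 h2 => by simp [hH', h1, h2]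
  have key : (x ≠ k → ((L.filter (· ≠ k)).map H').prod = (L.map H).prod) ∧
      (x = k → H k * (L.map H).prod = ((L.filter (· ≠ k)).map H').prod) := by
    clear hx
    induction h with
    | @last x h =>
      refine ⟨fun hx => ?_, ?_⟩
      · have : a ≠ π k := by rw [← h]; exact fun h' => hx (π.injective h')
        simp [hka.symm, hne a hka.symm this]
      · rintro rfl
        simp [← h, hl, hk]
    | @step x L h hL ih =>
      refine ⟨fun hx => ?_, ?_⟩
      · by_cases hy : π x = k
        · simpa [hy] using (ih.2 hy).symm
        · simpa [hy, hne _ hy fun h' => hx (π.injective h')] using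
            congrArg (H (π x) * ·) (ih.1 hy)
      · rintro rfl
        have := ih.1 hk
        simp only [ne_eq, decide_not] at this
        simp [hk, hl, this, mul_assoc]
  exact key.1 hx

/-- Moving the base point of a walk to its first point. -/
theorem rotate {R : Type*} [Monoid R] (ha : π a ≠ a) (h : CycleWalk π a a L) (H : α → R) :
    ∃ L', CycleWalk π (π a) (π a) L' ∧ (∀ y, y ∈ L' ↔ y ∈ L) ∧
      (L.map H).prod = H (π a) * (L'.map (Function.update H (π a) 1)).prod := by
  have key : ∀ {x L}, CycleWalk π a x L → x ≠ a → CycleWalk π (π a) x (L ++ [π a]) ∧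
      ((L ++ [π a]).map (Function.update H (π a) 1)).prod = (L.map H).prod := by
    intro x L h
    induction h with
    | @last x h =>
      intro hx
      refine ⟨?_, by simp [ha.symm]⟩
      have := CycleWalk.step (π := π) (a := π a) (x := x) (L := [π a])
        (by rw [h]; exact ha.symm) (.last (by rw [h]))
      simpa [h] using this
    | @step x L h hL ih =>
      intro hx
      obtain ⟨h1, h2⟩ := ih h
      have h3 : π x ≠ π a := fun h' => hx (π.injective h')
      exact ⟨.step h3 h1, by
        simpa [Function.update_of_ne h3] using congrArg (H (π x) * ·) h2⟩
  rcases h with h' | ⟨h', hL⟩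
  · exact absurd h' ha
  · obtain ⟨h1, h2⟩ := key hL ha
    exact ⟨_, h1, by simp [or_comm], by rw [h2]; simp⟩

end CycleWalk

section TraceMonomial

open Equiv Finset Function

variable {α ι K R : Type*} [Fintype α] [DecidableEq α] [Fintype ι] [DecidableEq ι] [CommRing K]
  [Ring R] [Algebra K R] (Φ : R →ₐ[K] Matrix ι ι K)

/-- The points of the cycle of `π` through `a`, listed so as to end with `a`. -/
noncomputable def walkList (π : Perm α) (a : α) : List α :=
  (CycleWalk.exists_walk π a).choose

omit [DecidableEq α] in
theorem cycleWalk_walkList (π : Perm α) (a : α) : CycleWalk π a a (walkList π a) :=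
  (CycleWalk.exists_walk π a).choose_spec

omit [DecidableEq α] in
theorem walkList_eq {π : Perm α} {a : α} {L : List α} (h : CycleWalk π a a L) :
    walkList π a = L :=
  (cycleWalk_walkList π a).unique h

/-- The product of the `H k` along the cycle of `π` through `a`, times the traces along the other
cycles, times `card ι`. -/
noncomputable def traceMonomial (π : Perm α) (a : α) (H : α → R) : R :=
  permTrace π (fun k => if k ∈ walkList π a then 1 else Φ (H k)) •
    ((walkList π a).map H).prod

theorem traceMonomial_eq {π : Perm α} {a : α} {L : List α} (h : CycleWalk π a a L) (H : α → R) :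
    traceMonomial Φ π a H =
      permTrace π (fun k => if k ∈ L then 1 else Φ (H k)) • (L.map H).prod := by
  rw [traceMonomial, walkList_eq h]

theorem traceMonomial_merge {π : Perm α} {a k : α} (hka : k ≠ a) (hk : π k ≠ k) (H : α → R) :
    (Fintype.card ι : K) • traceMonomial Φ π a H =
      traceMonomial Φ (swap k (π k) * π) a (update (update H (π k) (H k * H (π k))) k 1) := by
  have h := cycleWalk_walkList π a
  rw [traceMonomial_eq Φ h, traceMonomial_eq Φ (h.merge hka hk hka.symm),
    h.merge_prod hka hk hka.symm, smul_smul, permTrace_merge π k hk]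
  congr 2
  have hmem : π k ∈ walkList π a ↔ k ∈ walkList π a :=
    ⟨fun h' => h.mem_of_apply_mem h' hka, fun h' => h.apply_mem h' hka⟩
  funext y
  by_cases hy : y = k
  · subst hy; simp
  · by_cases hy' : y = π k
    · subst hy'
      by_cases hm : k ∈ walkList π a <;> simp [hy, hmem, hm]
    · simp [hy, hy']

theorem traceMonomial_rotate {π : Perm α} {a : α} (ha : π a ≠ a) (H : α → R) :
    traceMonomial Φ π a H = H (π a) * traceMonomial Φ π (π a) (update H (π a) 1) := by
  obtain ⟨L, h1, h2, h3⟩ := (cycleWalk_walkList π a).rotate ha H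
  rw [traceMonomial_eq Φ h1, traceMonomial, h3, mul_smul_comm]
  congr 2
  funext y
  by_cases hy : y = π a
  · subst hy
    rw [if_pos h1.mem_last, if_pos ((h2 _).1 h1.mem_last)]
  · simp [h2, hy]

theorem traceMonomial_fixed {π : Perm α} {a : α} (ha : π a = a) (H : α → R) :
    traceMonomial Φ π a H = permTrace π (update (fun k => Φ (H k)) a 1) • H a := by
  rw [traceMonomial_eq Φ (.last ha)]
  congr 2
  · funext y
    by_cases hy : y = a <;> simp [hy]
  · simp

theorem traceMonomial_conj (g π : Perm α) (a : α) (H : α → R) :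
    traceMonomial Φ (g * π * g⁻¹) (g a) H = traceMonomial Φ π a (fun k => H (g k)) := by
  have h := cycleWalk_walkList π a
  rw [traceMonomial_eq Φ h, traceMonomial_eq Φ (h.conj g), permTrace_conj, List.map_map]
  congr 2
  funext y
  simp

omit [Fintype α] in
theorem prod_map_update_mul {R : Type*} [Monoid R] {L : List α} (hL : L.Nodup) {i : α}
    (hi : i ∈ L) (H : α → R) : ∃ p q : R, ∀ x, (L.map (update H i x)).prod = p * x * q := by
  obtain ⟨L₁, L₂, rfl⟩ := List.append_of_mem hi
  refine ⟨(L₁.map H).prod, (L₂.map H).prod, fun x => ?_⟩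
  have hd := List.nodup_append.mp hL
  have h1 : L₁.map (update H i x) = L₁.map H := List.map_congr_left fun y hy =>
    update_of_ne (hd.2.2 y hy i (by simp)) _ _
  have h2 : L₂.map (update H i x) = L₂.map H := List.map_congr_left fun y hy =>
    update_of_ne (by rintro rfl; exact (List.nodup_cons.mp hd.2.1).1 hy) _ _
  simp [h1, h2, mul_assoc]

omit [Fintype α] in
theorem map_update_eq_of_notMem {R : Type*} {L : List α} {i : α}
    (hi : i ∉ L) (H : α → R) (x : R) : L.map (update H i x) = L.map H :=
  List.map_congr_left fun _ hy => update_of_ne (by rintro rfl; exact hi hy) _ _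

omit [DecidableEq ι] in
/-- `permTrace` depends linearly on each matrix. -/
theorem permTrace_update (π : Perm α) (B : α → Matrix ι ι K) (i : α) :
    ∃ c : Matrix ι ι K →ₗ[K] K, ∀ M, permTrace π (update B i M) = c M := by
  refine ⟨∑ j : α → ι, (∏ k ∈ univ.erase i, B k (j k) (j (π k))) •
    (Matrix.entryLinearMap K K (j i) (j (π i))), fun M => ?_⟩
  simp only [permTrace, LinearMap.sum_apply, LinearMap.smul_apply, smul_eq_mul,
    Matrix.entryLinearMap_apply]
  refine sum_congr rfl fun j _ => ?_
  rw [← mul_prod_erase univ _ (mem_univ i), mul_comm, update_self]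
  congr 1
  refine prod_congr rfl fun k hk => ?_
  rw [update_of_ne (ne_of_mem_erase hk)]

theorem traceMonomial_update (π : Perm α) (a : α) (H : α → R) (i : α) :
    ∃ f : R →ₗ[K] R, ∀ x, traceMonomial Φ π a (update H i x) = f x := by
  have h := cycleWalk_walkList π a
  by_cases hi : i ∈ walkList π a
  · obtain ⟨p, q, hpq⟩ := prod_map_update_mul h.nodup hi H
    refine ⟨permTrace π (fun k => if k ∈ walkList π a then 1 else Φ (H k)) •
      (LinearMap.mulRight K q ∘ₗ LinearMap.mulLeft K p), fun x => ?_⟩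
    rw [traceMonomial, hpq]
    simp only [LinearMap.smul_apply, LinearMap.comp_apply, LinearMap.mulLeft_apply,
      LinearMap.mulRight_apply]
    congr 2
    funext y
    by_cases hy : y = i
    · subst hy; simp [hi]
    · simp [hy]
  · obtain ⟨c, hc⟩ := permTrace_update π
      (fun k => if k ∈ walkList π a then 1 else Φ (H k)) i
    refine ⟨(c ∘ₗ Φ.toLinearMap).smulRight (((walkList π a).map H).prod), fun x => ?_⟩
    rw [traceMonomial, map_update_eq_of_notMem hi]
    simp only [LinearMap.smulRight_apply, LinearMap.comp_apply, AlgHom.toLinearMap_apply, ← hc]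
    congr 2
    funext y
    by_cases hy : y = i
    · subst hy; simp [hi]
    · simp [hy]

/-- `traceMonomial` as a multilinear map. -/
noncomputable def traceMonomialMultilinear (π : Perm α) (a : α) :
    MultilinearMap K (fun _ : α => R) R :=
  MultilinearMap.mk' (traceMonomial Φ π a)
    (by
      intro H i x y
      obtain ⟨f, hf⟩ := traceMonomial_update Φ π a H i
      rw [hf, hf, hf, map_add])
    (by
      intro H i c x
      obtain ⟨f, hf⟩ := traceMonomial_update Φ π a H i
      rw [hf, hf, map_smul])

@[simp]
theorem traceMonomialMultilinear_apply (π : Perm α) (a : α) (H : α → R) :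
    traceMonomialMultilinear Φ π a H = traceMonomial Φ π a H :=
  rfl

end TraceMonomial

section Polarization

open Equiv Finset Function

/-- Inclusion–exclusion for a multilinear map evaluated at partial sums: only the terms indexed by
surjections survive. -/
theorem sum_powerset_neg_one_pow_multilinear {K M M' ι κ : Type*} [CommRing K] [AddCommGroup M]
    [Module K M] [AddCommGroup M'] [Module K M'] [Fintype ι] [DecidableEq ι] [Fintype κ]
    [DecidableEq κ] (f : MultilinearMap K (fun _ : ι => M) M') (v : ι → κ → M) :
    ∑ U : Finset κ, (-1 : ℤ) ^ #U • f (fun j => ∑ i ∈ U, v j i) =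
      (-1 : ℤ) ^ Fintype.card κ • ∑ g : ι → κ with Surjective g, f (fun j => v j (g j)) := by
  have h1 : ∀ U : Finset κ, f (fun j => ∑ i ∈ U, v j i) =
      ∑ g : ι → κ, if ∀ j, g j ∈ U then f (fun j => v j (g j)) else 0 := by
    intro U
    rw [MultilinearMap.map_sum_finset, ← sum_filter]
    refine sum_congr ?_ fun _ _ => rfl
    ext g
    simp
  simp only [h1, smul_sum]
  rw [sum_comm, sum_filter]
  refine sum_congr rfl fun g _ => ?_
  split_ifs with hg
  · rw [sum_eq_single univ]
    · simp
    · intro U _ hU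
      rw [if_neg, smul_zero]
      intro h
      refine hU (eq_univ_of_forall fun i => ?_)
      obtain ⟨j, rfl⟩ := hg i
      exact h j
    · simp
  · obtain ⟨i, hi⟩ := not_forall.mp hg
    push Not at hi
    rw [← powerset_univ, ← insert_erase (mem_univ i), sum_powerset_insert (notMem_erase i _),
      ← sum_add_distrib]
    refine sum_eq_zero fun t ht => ?_
    have hit : i ∉ t := fun h => notMem_erase i univ (mem_powerset.mp ht h)
    rw [card_insert_of_notMem hit]
    simp only [mem_insert, hi, false_or, smul_ite, smul_zero]
    split_ifs <;> simp [pow_succ]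

theorem sum_powerset_neg_one_pow_multilinear_perm {K M M' ι : Type*} [CommRing K] [AddCommGroup M]
    [Module K M] [AddCommGroup M'] [Module K M'] [Fintype ι] [DecidableEq ι]
    (f : MultilinearMap K (fun _ : ι => M) M') (v : ι → ι → M) :
    ∑ U : Finset ι, (-1 : ℤ) ^ #U • f (fun j => ∑ i ∈ U, v j i) =
      (-1 : ℤ) ^ Fintype.card ι • ∑ g : Perm ι, f (fun j => v j (g j)) := by
  rw [sum_powerset_neg_one_pow_multilinear]
  congr 1
  symm
  refine sum_bij (fun g _ => ⇑g) (by simp [Equiv.surjective]) (by simp) ?_ (by simp)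
  intro g hg
  have hg := Finite.surjective_iff_bijective.mp (mem_filter.mp hg).2
  exact ⟨ofBijective g hg, by simp, rfl⟩

theorem sum_powerset_neg_one_pow_multilinear_eq_zero {K M M' ι κ : Type*} [CommRing K]
    [AddCommGroup M] [Module K M] [AddCommGroup M'] [Module K M'] [Fintype ι] [DecidableEq ι]
    [Fintype κ] [DecidableEq κ] (h : Fintype.card ι < Fintype.card κ)
    (f : MultilinearMap K (fun _ : ι => M) M') (v : ι → κ → M) :
    ∑ U : Finset κ, (-1 : ℤ) ^ #U • f (fun j => ∑ i ∈ U, v j i) = 0 := by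
  rw [sum_powerset_neg_one_pow_multilinear, sum_eq_zero, smul_zero]
  intro g hg
  exact absurd (Fintype.card_le_of_surjective g (mem_filter.mp hg).2) (not_le.mpr h)

end Polarization

section Antisymmetrizer

open Equiv Finset Function

variable {α ι K R : Type*} [Fintype α] [DecidableEq α] [Fintype ι] [DecidableEq ι] [CommRing K]
  [Ring R] [Algebra K R] (Φ : R →ₐ[K] Matrix ι ι K)

/-- The signed sum of the trace monomials of `σ * τ`, where `τ` permutes `S`. -/
noncomputable def antisymMonomial (S : Finset α) (σ : Perm α) (a : α) (H : α → R) : R :=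
  ∑ τ ∈ permsOn S, ((Perm.sign τ : ℤˣ) : ℤ) • traceMonomial Φ (σ * τ) a H

theorem antisymMonomial_merge {S : Finset α} {σ : Perm α} {a k : α} (hkS : k ∉ S) (hka : k ≠ a)
    (hk : σ k ≠ k) (H : α → R) :
    (Fintype.card ι : K) • antisymMonomial Φ S σ a H =
      antisymMonomial Φ S (swap k (σ k) * σ) a
        (update (update H (σ k) (H k * H (σ k))) k 1) := by
  rw [antisymMonomial, antisymMonomial, smul_sum]
  refine sum_congr rfl fun τ hτ => ?_
  have h : (σ * τ) k = σ k := by rw [Perm.mul_apply, mem_permsOn.mp hτ k hkS]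
  rw [smul_comm, traceMonomial_merge Φ hka (by rwa [h]), h, mul_assoc]

theorem antisymMonomial_rotate {S : Finset α} {σ : Perm α} {a : α} (haS : a ∉ S)
    (ha : σ a ≠ a) (H : α → R) :
    antisymMonomial Φ S σ a H = H (σ a) * antisymMonomial Φ S σ (σ a) (update H (σ a) 1) := by
  rw [antisymMonomial, antisymMonomial, mul_sum]
  refine sum_congr rfl fun τ hτ => ?_
  have h : (σ * τ) a = σ a := by rw [Perm.mul_apply, mem_permsOn.mp hτ a haS]
  rw [traceMonomial_rotate Φ (by rwa [h]), h, mul_smul_comm]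

theorem antisymMonomial_fixed [IsAddTorsionFree K] {S : Finset α} {σ : Perm α} {a : α}
    (hS : Fintype.card ι < #S) (haS : a ∉ S) (ha : σ a = a) (H : α → R) :
    antisymMonomial Φ S σ a H = 0 := by
  have h0 := sum_sign_permTrace_eq_zero S hS σ (update (fun k => Φ (H k)) a 1)
  have h := congrArg (· • H a) h0
  simp only [zero_smul, sum_smul] at h
  rw [antisymMonomial, ← h]
  refine sum_congr rfl fun τ hτ => ?_
  rw [traceMonomial_fixed Φ (by rw [Perm.mul_apply, mem_permsOn.mp hτ a haS, ha]), smul_assoc]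

theorem antisymMonomial_of_mem_permsOn {S : Finset α} {σ : Perm α} (hσ : σ ∈ permsOn S) (a : α)
    (H : α → R) :
    antisymMonomial Φ S σ a H = ((Perm.sign σ : ℤˣ) : ℤ) • antisymMonomial Φ S 1 a H := by
  have h := sum_permsOn_mul_left hσ
    (fun τ => ((Perm.sign τ : ℤˣ) : ℤ) • traceMonomial Φ τ a H)
  simp only [antisymMonomial, one_mul, ← h, smul_sum, smul_smul, ← Units.val_mul, ← Perm.sign_mul]
  refine sum_congr rfl fun τ _ => ?_
  rw [← mul_assoc, Perm.sign_mul, Perm.sign_mul, Int.units_mul_self, one_mul]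

theorem antisymMonomial_one_comp {S : Finset α} {g : Perm α} (hg : g ∈ permsOn S) {a : α}
    (ha : g a = a) (H : α → R) :
    antisymMonomial Φ S 1 a (fun k => H (g k)) = antisymMonomial Φ S 1 a H := by
  simp only [antisymMonomial, one_mul]
  refine sum_bij' (fun τ _ => g * τ * g⁻¹) (fun τ _ => g⁻¹ * τ * g)
    (fun τ h => mul_mem_permsOn (mul_mem_permsOn hg h) (inv_mem_permsOn hg))
    (fun τ h => mul_mem_permsOn (mul_mem_permsOn (inv_mem_permsOn hg) h) hg)
    (by simp [mul_assoc]) (by simp [mul_assoc]) fun τ _ => ?_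
  have h := traceMonomial_conj Φ g τ a H
  rw [ha] at h
  rw [h, Perm.sign_mul, Perm.sign_mul, Perm.sign_inv, mul_comm, ← mul_assoc, Int.units_mul_self,
    one_mul]

/-- Expanding over the image of the base point. -/
theorem sum_permsOn_eq_sum_swap {M : Type*} [AddCommMonoid M] {S : Finset α} {a : α} (ha : a ∈ S)
    (f : Perm α → M) :
    ∑ τ ∈ permsOn S, f τ = ∑ l ∈ S, ∑ τ ∈ permsOn (S.erase a), f (swap a l * τ) := by
  rw [← sum_product']
  refine sum_bij' (fun τ _ => (τ a, swap a (τ a) * τ)) (fun p _ => swap a p.1 * p.2)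
    ?_ ?_ ?_ ?_ ?_
  · intro τ hτ
    have h1 : τ a ∈ S := by
      by_contra h
      exact h (by rwa [τ.injective (mem_permsOn.mp hτ _ h)])
    refine mem_product.mpr ⟨h1, mem_permsOn.mpr fun y hy => ?_⟩
    by_cases hya : y = a
    · simp [hya]
    · exact mem_permsOn.mp (mul_mem_permsOn (swap_mem_permsOn ha h1) hτ) y
        fun h => hy (mem_erase.mpr ⟨hya, h⟩)
  · rintro ⟨l, τ⟩ h
    obtain ⟨h1, h2⟩ := mem_product.mp h
    refine mul_mem_permsOn (swap_mem_permsOn ha h1) (mem_permsOn.mpr fun y hy =>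
      mem_permsOn.mp h2 y fun h => hy (mem_of_mem_erase h))
  · intro τ _
    simp
  · rintro ⟨l, τ⟩ h
    have h2 := mem_permsOn.mp (mem_product.mp h).2 a (notMem_erase a S)
    simp [h2]
  · intro τ _
    simp

theorem card_smul_antisymMonomial_one {S : Finset α} {a : α} (ha : a ∈ S) (H : α → R) :
    (Fintype.card ι : K) • antisymMonomial Φ S 1 a H =
      (Fintype.card ι : K) • (∑ τ ∈ permsOn (S.erase a), ((Perm.sign τ : ℤˣ) : ℤ) •
        permTrace τ (update (fun k => Φ (H k)) a 1)) • H a -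
      ∑ l ∈ S.erase a, H l *
        antisymMonomial Φ (S.erase a) 1 l (update (update H l (H a)) a 1) := by
  have key : ∀ l ∈ S.erase a, (Fintype.card ι : K) • ∑ τ ∈ permsOn (S.erase a),
      ((Perm.sign (swap a l * τ) : ℤˣ) : ℤ) • traceMonomial Φ (swap a l * τ) a H =
      - (H l * antisymMonomial Φ (S.erase a) 1 l (update (update H l (H a)) a 1)) := by
    intro l hl
    have hla : l ≠ a := ne_of_mem_erase hl
    rw [antisymMonomial, mul_sum, smul_sum, ← sum_neg_distrib]
    refine sum_congr rfl fun τ hτ => ?_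
    have hτa : τ a = a := mem_permsOn.mp hτ a (notMem_erase a S)
    have h1 : (swap a l * τ) a = l := by rw [Perm.mul_apply, hτa, swap_apply_left]
    have h2 := traceMonomial_rotate Φ (π := swap a l * τ) (a := a) (by rwa [h1]) H
    rw [h1] at h2
    have h3 := traceMonomial_merge Φ (π := swap a l * τ) (a := l) (k := a) hla.symm
      (by rwa [h1]) (update H l 1)
    rw [h1] at h3
    rw [smul_comm, h2, ← mul_smul_comm (Fintype.card ι : K), h3, Perm.sign_mul,
      Perm.sign_swap hla.symm, ← mul_assoc, swap_mul_self, one_mul]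
    rw [mul_smul_comm, neg_one_mul, Units.val_neg, neg_smul]
    simp only [update_idem, update_self, update_of_ne hla.symm, mul_one]
  conv_lhs => rw [antisymMonomial]
  simp only [one_mul]
  rw [sum_permsOn_eq_sum_swap ha, ← add_sum_erase S _ ha, smul_add, smul_sum (s := S.erase a),
    sum_congr rfl key, sum_neg_distrib, ← sub_eq_add_neg]
  congr 2
  rw [sum_smul]
  refine sum_congr rfl fun τ hτ => ?_
  have hτa : τ a = a := mem_permsOn.mp hτ a (notMem_erase a S)
  rw [swap_self]
  change ((Perm.sign (1 * τ) : ℤˣ) : ℤ) • traceMonomial Φ (1 * τ) a H = _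
  rw [one_mul, traceMonomial_fixed Φ hτa, smul_assoc]

end Antisymmetrizer

section CayleyHamilton

open Equiv Finset Function

variable {α ι K R : Type*} [Fintype α] [DecidableEq α] [Fintype ι] [DecidableEq ι] [CommRing K]
  [Ring R] [Algebra K R] (Φ : R →ₐ[K] Matrix ι ι K)

/-- Up to the sign `(-1) ^ r`, the truncation of the characteristic polynomial of `Φ h` to its
`r + 1` leading coefficients, evaluated at `h`. -/
noncomputable def charpolyTrunc (h : R) : ℕ → R
  | 0 => algebraMap K R ((Φ h).charpoly.coeff (Fintype.card ι))
  | r + 1 => ((-1) ^ (r + 1) * (Φ h).charpoly.coeff (Fintype.card ι - (r + 1))) • (1 : R) -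
      h * charpolyTrunc h r

theorem charpolyTrunc_eq (h : R) (r : ℕ) :
    charpolyTrunc Φ h r = (-1) ^ r * ∑ i ∈ range (r + 1),
      algebraMap K R ((Φ h).charpoly.coeff (Fintype.card ι - (r - i))) * h ^ i := by
  induction r with
  | zero => simp [charpolyTrunc]
  | succ r ih =>
    rw [charpolyTrunc, ih, sum_range_succ' _ (r + 1), mul_add _ _ (_ * _), add_comm (_ * _),
      sub_eq_add_neg, Algebra.smul_def, mul_one]
    congr 1
    · simp
    · rw [mul_sum, mul_sum, mul_sum, ← sum_neg_distrib]
      refine sum_congr rfl fun i _ => ?_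
      rw [show r + 1 - (i + 1) = r - i by omega, pow_succ' h i, ← mul_assoc h,
        ((Commute.neg_one_right h).pow_right r).eq, mul_assoc, ← mul_assoc h,
        ← Algebra.commutes _ h]
      simp [pow_succ, mul_assoc]

variable [Nonempty ι] [Nontrivial K] [IsAddTorsionFree R]

theorem antisymMonomial_one_const {S : Finset α} {a : α} (ha : a ∈ S) {r : ℕ} (hr : #S = r + 1)
    (hrN : r ≤ Fintype.card ι) (h : R) (H : α → R) (hH : ∀ k ∈ S.erase a, H k = h) :
    antisymMonomial Φ S 1 a H =
      ((Fintype.card ι : K) * (∏ k ∈ Sᶜ, (Φ (H k)).trace) * (r.factorial : K)) •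
        (charpolyTrunc Φ h r * H a) := by
  have hcancel : ∀ x y : R, (Fintype.card ι : K) • x = (Fintype.card ι : K) • y → x = y := by
    intro x y hxy
    rw [Nat.cast_smul_eq_nsmul, Nat.cast_smul_eq_nsmul] at hxy
    exact nsmul_right_injective Fintype.card_ne_zero hxy
  induction r generalizing S a H with
  | zero =>
    obtain ⟨b, rfl⟩ := card_eq_one.mp hr
    obtain rfl : a = b := by simpa using ha
    apply hcancel
    rw [card_smul_antisymMonomial_one Φ ha]
    have h0 := sum_sign_permTrace_const (({a} : Finset α).erase a) (by simp) (1 : Matrix ι ι K)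
      (update (fun k => Φ (H k)) a 1) (by simp)
    rw [h0]
    have h1 : (Φ h).charpoly.coeff (Fintype.card ι) = 1 := by
      have := (Φ h).charpoly_monic
      rwa [Polynomial.Monic, Polynomial.leadingCoeff, Matrix.charpoly_natDegree_eq_dim] at this
    have h2 : (1 : Matrix ι ι K).charpoly.coeff (Fintype.card ι) = 1 := by
      have := (1 : Matrix ι ι K).charpoly_monic
      rwa [Polynomial.Monic, Polynomial.leadingCoeff, Matrix.charpoly_natDegree_eq_dim] at this
    have h3 : ∏ k : α, (update (fun k => Φ (H k)) a 1 k).trace =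
        (Fintype.card ι : K) * ∏ k ∈ ({a} : Finset α)ᶜ, (Φ (H k)).trace := by
      rw [← mul_prod_erase univ _ (mem_univ a), update_self, Matrix.trace_one]
      congr 1
      rw [show ({a} : Finset α)ᶜ = univ.erase a by ext; simp]
      refine prod_congr rfl fun k hk => ?_
      rw [update_of_ne (ne_of_mem_erase hk)]
    simp [charpolyTrunc, h1, h2, h3]
  | succ r ih =>
    have hS' : #(S.erase a) = r + 1 := by rw [card_erase_of_mem ha, hr]; rfl
    have hprod : ∀ f : α → K, f a = Fintype.card ι → ∏ k ∈ (S.erase a)ᶜ, f k =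
        (Fintype.card ι : K) * ∏ k ∈ Sᶜ, f k := by
      intro f hf
      rw [show (S.erase a)ᶜ = insert a Sᶜ by ext; simp, prod_insert (by simpa), hf]
    apply hcancel
    rw [card_smul_antisymMonomial_one Φ ha]
    have h0 := sum_sign_permTrace_const (S.erase a) (by omega) (Φ h)
      (update (fun k => Φ (H k)) a 1) fun k hk => by
        rw [update_of_ne (ne_of_mem_erase hk), hH k hk]
    have hne : ∀ k ∈ Sᶜ, k ≠ a := fun k hk h => by simp [h, ha] at hk
    rw [h0, hprod _ (by simp), hS']
    have h1 : ∀ l ∈ S.erase a, H l *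
        antisymMonomial Φ (S.erase a) 1 l (update (update H l (H a)) a 1) =
        ((Fintype.card ι : K) * ((Fintype.card ι : K) * ∏ k ∈ Sᶜ, (Φ (H k)).trace) *
          (r.factorial : K)) • (h * (charpolyTrunc Φ h r * H a)) := by
      intro l hl
      have hla := ne_of_mem_erase hl
      rw [ih hl hS' (by omega) _ fun k hk => ?_, hprod _ (by simp), hH l hl]
      · rw [mul_smul_comm, update_of_ne hla, update_self]
        congr 3
        congr 1
        refine prod_congr rfl fun k hk => ?_
        rw [update_of_ne (hne k hk), update_of_ne]
        rintro rfl
        exact mem_compl.mp hk (mem_of_mem_erase hl)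
      · have hk' := mem_of_mem_erase hk
        rw [update_of_ne (ne_of_mem_erase hk'), update_of_ne (ne_of_mem_erase hk), hH k hk']
    rw [sum_congr rfl h1, sum_const, hS', charpolyTrunc, sub_mul, smul_sub, smul_sub]
    have h2 : ∏ k ∈ Sᶜ, (update (fun k => Φ (H k)) a 1 k).trace = ∏ k ∈ Sᶜ, (Φ (H k)).trace :=
      prod_congr rfl fun k hk => by rw [update_of_ne (hne k hk)]
    rw [h2]
    congr 1
    · rw [smul_mul_assoc, one_mul, smul_smul, smul_smul, smul_smul]
      congr 1
      ring
    · rw [← Nat.cast_smul_eq_nsmul K, smul_smul, smul_smul, mul_assoc h]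
      congr 1
      push_cast [Nat.factorial_succ]
      ring

variable {J : Ideal R} (hJr : ∀ x ∈ J, ∀ r, x * r ∈ J)
  (hJd : ∀ (m : ℕ) (x : R), m ≠ 0 → m • x ∈ J → x ∈ J)
  (hJ : ∀ h : R, ∑ i ∈ range (Fintype.card ι + 1),
    algebraMap K R ((Φ h).charpoly.coeff i) * h ^ i ∈ J)

include hJr hJd hJ

theorem antisymMonomial_one_mem {S : Finset α} (hS : #S = Fintype.card ι + 1) {a : α} (ha : a ∈ S)
    (H : α → R) : antisymMonomial Φ S 1 a H ∈ J := by
  let P : α → Prop := fun k => k ∈ S.erase a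
  let f : MultilinearMap K (fun _ : {k // P k} => R) R :=
    (∑ τ ∈ permsOn S, ((Perm.sign τ : ℤˣ) : ℤ) •
      traceMonomialMultilinear Φ τ a).domDomRestrict P fun k => H k
  have hf : ∀ v, f v = antisymMonomial Φ S 1 a fun k => if h : P k then v ⟨k, h⟩ else H k := by
    intro v
    simp [f, antisymMonomial, MultilinearMap.domDomRestrict_apply]
  have hdiag : ∀ h : R, f (fun _ => h) ∈ J := by
    intro h
    rw [hf, antisymMonomial_one_const Φ ha hS le_rfl h]
    · rw [Algebra.smul_def]
      refine J.mul_mem_left _ (hJr _ ?_ _)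
      rw [charpolyTrunc_eq]
      refine J.mul_mem_left _ ?_
      convert hJ h using 3 with i hi
      rw [Nat.sub_sub_self (by simpa [Nat.lt_succ_iff] using hi)]
    · intro k hk
      rw [dif_pos hk]
  have hsym : ∀ (v : {k // P k} → R) (g : Perm {k // P k}), f (fun k => v (g k)) = f v := by
    intro v g
    have hg : Perm.ofSubtype g ∈ permsOn S := mem_permsOn.mpr fun y hy =>
      Perm.ofSubtype_apply_of_not_mem g fun h => hy (mem_of_mem_erase h)
    rw [hf, hf, ← antisymMonomial_one_comp Φ hg
      (Perm.ofSubtype_apply_of_not_mem g (notMem_erase a S))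
      fun k => if h : P k then v ⟨k, h⟩ else H k]
    congr 1
    funext k
    by_cases hk : P k
    · have : P (Perm.ofSubtype g k) := by
        rw [Perm.ofSubtype_apply_of_mem g hk]; exact (g ⟨k, hk⟩).2
      rw [dif_pos hk, dif_pos this]
      congr 1
      exact Subtype.ext (Perm.ofSubtype_apply_of_mem g hk).symm
    · rw [Perm.ofSubtype_apply_of_not_mem g hk, dif_neg hk, dif_neg hk]
  have h1 := sum_powerset_neg_one_pow_multilinear_perm f fun _ k => H k
  have h2 : ∑ U : Finset {k // P k}, (-1 : ℤ) ^ #U • f (fun _ => ∑ i ∈ U, H i) ∈ J :=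
    J.sum_mem fun U _ => J.toAddSubgroup.zsmul_mem (hdiag _) _
  rw [h1] at h2
  simp only [hsym (fun k => H k)] at h2
  rw [sum_const, card_univ] at h2
  have h3 := J.toAddSubgroup.zsmul_mem h2 ((-1) ^ Fintype.card {k // P k})
  rw [smul_smul, ← mul_pow, neg_one_mul, neg_neg, one_pow, one_smul] at h3
  have h4 := hJd _ _ (Fintype.card_ne_zero) h3
  rw [hf] at h4
  simpa using h4

/-- Antisymmetrizing a trace monomial over `card ι + 1` points gives a consequence of the
Cayley–Hamilton identity. -/
theorem antisymMonomial_mem [IsAddTorsionFree K] {S : Finset α} (hS : #S = Fintype.card ι + 1)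
    (σ : Perm α) (a : α) (H : α → R) : antisymMonomial Φ S σ a H ∈ J := by
  have hcancel : ∀ x : R, (Fintype.card ι : K) • x ∈ J → x ∈ J := by
    intro x hx
    rw [Nat.cast_smul_eq_nsmul] at hx
    exact hJd _ _ Fintype.card_ne_zero hx
  have hlt : ∀ (σ : Perm α) (k : α), k ∉ S → σ k ≠ k →
      #(univ.filter fun y => y ∉ S ∧ (swap k (σ k) * σ) y ≠ y) <
        #(univ.filter fun y => y ∉ S ∧ σ y ≠ y) := by
    intro σ k hkS hk
    refine card_lt_card ((ssubset_iff_of_subset fun y hy => ?_).mpr ⟨k, by simp [hkS, hk],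
      fun h => (mem_filter.mp h).2.2 (by simp)⟩)
    simp only [mem_filter, mem_univ, true_and] at hy ⊢
    refine ⟨hy.1, fun h => hy.2 ?_⟩
    have hyk : y ≠ k := by rintro rfl; exact hk h
    rw [Perm.mul_apply, h, swap_apply_of_ne_of_ne hyk]
    intro h'
    exact hyk (σ.injective (h.trans h'))
  induction hm : #(univ.filter fun y => y ∉ S ∧ σ y ≠ y) using Nat.strong_induction_on
    generalizing σ a H with
  | _ m ih =>
  subst hm
  by_cases h1 : ∃ k, k ∉ S ∧ k ≠ a ∧ σ k ≠ k
  · obtain ⟨k, hkS, hka, hk⟩ := h1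
    apply hcancel
    rw [antisymMonomial_merge Φ hkS hka hk]
    exact ih _ (hlt σ k hkS hk) _ _ _ rfl
  push Not at h1
  by_cases haS : a ∈ S
  · have hσ : σ ∈ permsOn S := mem_permsOn.mpr fun y hy => h1 y hy (by rintro rfl; exact hy haS)
    rw [antisymMonomial_of_mem_permsOn Φ hσ]
    exact J.toAddSubgroup.zsmul_mem (antisymMonomial_one_mem Φ hJr hJd hJ hS haS H) _
  · by_cases ha : σ a = a
    · rw [antisymMonomial_fixed Φ (by omega) haS ha]
      exact J.zero_mem
    · rw [antisymMonomial_rotate Φ haS ha]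
      refine J.mul_mem_left _ (hcancel _ ?_)
      rw [antisymMonomial_merge Φ haS (Ne.symm ha) ha]
      exact ih _ (hlt σ a haS ha) _ _ _ rfl

end CayleyHamilton

section Straightening

open Equiv Finset Function

variable {m : ℕ}

theorem Equiv.Perm.toLex_lt_of_first_ne {σ π : Perm (Fin m)} (hne : π ≠ σ)
    (h : ∀ k, (∀ j < k, π j = σ j) → π k ≠ σ k → σ k < π k) : toLex ⇑σ < toLex ⇑π := by
  have hne' : ⇑π ≠ ⇑σ := fun h' => hne (DFunLike.coe_injective h')
  obtain ⟨k, hk⟩ := Function.ne_iff.mp hne'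
  obtain ⟨k, hk, hmin⟩ := WellFounded.has_min (wellFounded_lt (α := Fin m)) {k | π k ≠ σ k} ⟨k, hk⟩
  have hlt : ∀ j < k, π j = σ j := fun j hj => by
    by_contra hj'
    exact hmin j hj' hj
  exact ⟨k, fun j hj => (hlt j hj).symm, h k hlt hk⟩

theorem Equiv.Perm.toLex_mul_lt {σ τ : Perm (Fin m)} {S : Finset (Fin m)}
    (hS : StrictAntiOn σ S) (hτ : τ ∈ permsOn S) (hne : τ ≠ 1) :
    toLex ⇑(σ * τ) < toLex ⇑σ := by
  refine toLex_lt_of_first_ne (fun h => hne (mul_eq_left.mp h.symm)) fun k hlt hk => ?_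
  have hτk : τ k ≠ k := fun h => hk (by rw [Perm.mul_apply, h])
  have hkS : k ∈ S := by
    by_contra h
    exact hτk (mem_permsOn.mp hτ k h)
  have hτkS : τ k ∈ S := by
    by_contra h
    exact h (by rwa [τ.injective (mem_permsOn.mp hτ _ h)])
  refine hS hkS hτkS (lt_of_le_of_ne (not_lt.mp fun h => hτk ?_) hτk.symm)
  have := hlt _ h
  rw [Perm.mul_apply] at this
  exact (τ.injective (σ.injective this)).symm

/-- The length of the longest decreasing subsequence of `σ` that ends at `i`. -/
noncomputable def decreasingRank (σ : Perm (Fin m)) (i : Fin m) : ℕ := by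
  classical exact (univ.filter fun S : Finset (Fin m) =>
    i ∈ S ∧ (∀ x ∈ S, x ≤ i) ∧ StrictAntiOn σ S).sup card

theorem card_le_decreasingRank {σ : Perm (Fin m)} {i : Fin m} {S : Finset (Fin m)} (hi : i ∈ S)
    (hle : ∀ x ∈ S, x ≤ i) (hS : StrictAntiOn σ S) : #S ≤ decreasingRank σ i := by
  classical
  exact le_sup (f := card) (mem_filter.mpr ⟨mem_univ _, hi, hle, hS⟩)

theorem exists_card_eq_decreasingRank (σ : Perm (Fin m)) (i : Fin m) :
    ∃ S : Finset (Fin m), i ∈ S ∧ (∀ x ∈ S, x ≤ i) ∧ StrictAntiOn σ S ∧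
      #S = decreasingRank σ i := by
  classical
  have hne : (univ.filter fun S : Finset (Fin m) =>
      i ∈ S ∧ (∀ x ∈ S, x ≤ i) ∧ StrictAntiOn σ S).Nonempty :=
    ⟨{i}, by simp [StrictAntiOn]⟩
  obtain ⟨S, hS, h⟩ := exists_mem_eq_sup _ hne card
  simp only [mem_filter, mem_univ, true_and] at hS
  refine ⟨S, hS.1, hS.2.1, hS.2.2, ?_⟩
  rw [decreasingRank, ← h]

theorem decreasingRank_lt {σ : Perm (Fin m)} {i j : Fin m} (hij : i < j) (h : σ j < σ i) :
    decreasingRank σ i < decreasingRank σ j := by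
  obtain ⟨S, hi, hle, hS, hc⟩ := exists_card_eq_decreasingRank σ i
  have hj : j ∉ S := fun h' => absurd (hle j h') (not_le.mpr hij)
  have hS' : StrictAntiOn σ (insert j S : Finset (Fin m)) := by
    intro x hx y hy hxy
    rw [mem_coe] at hx hy
    rcases mem_insert.mp hx with hxj | hx' <;> rcases mem_insert.mp hy with hyj | hy'
    · exact absurd hxy (by rw [hxj, hyj]; exact lt_irrefl _)
    · exact absurd (hxy.trans_le (hle y hy')) (by rw [hxj]; exact not_lt.mpr hij.le)
    · rw [hyj]
      rcases (hle x hx').eq_or_lt with hxi | hxi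
      · rwa [hxi]
      · exact h.trans (hS hx' hi hxi)
    · exact hS hx' hy' hxy
  have := card_le_decreasingRank (mem_insert_self j S) (fun x hx => by
    rcases mem_insert.mp hx with rfl | hx
    · exact le_rfl
    · exact (hle x hx).trans hij.le) hS'
  rw [card_insert_of_notMem hj] at this
  omega

theorem sum_sum_sign_ite_smul {K M : Type*} [Ring K] [AddCommGroup M] [Module K M]
    (σ : Perm (Fin m)) (S : Finset (Fin m)) (f : Perm (Fin m) → M) :
    ∑ π, (∑ τ ∈ permsOn S, ((Perm.sign τ : ℤˣ) : ℤ) • if σ * τ = π then (1 : K) else 0) • f π =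
      ∑ τ ∈ permsOn S, ((Perm.sign τ : ℤˣ) : ℤ) • f (σ * τ) := by
  simp only [sum_smul]
  rw [sum_comm]
  refine sum_congr rfl fun τ _ => ?_
  rw [sum_eq_single (σ * τ)]
  · rw [if_pos rfl, smul_assoc, one_smul]
  · intro π _ hπ
    rw [if_neg hπ.symm, smul_zero, zero_smul]
  · simp

variable {K V : Type*} [Field K] [CharZero K] [AddCommGroup V] [Module K V] {N : ℕ}

/-- A linear combination of permutations that acts as zero on tensor powers of `K ^ N` lies in the
span of the antisymmetrizers on `N + 1` points. -/
theorem sum_smul_mem_of_forall_sum_eq_zero (t : Perm (Fin m) → V) (W : Submodule K V)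
    (ht : ∀ (σ : Perm (Fin m)) (S : Finset (Fin m)), #S = N + 1 →
      ∑ τ ∈ permsOn S, ((Perm.sign τ : ℤˣ) : ℤ) • t (σ * τ) ∈ W)
    (b : Perm (Fin m) → K)
    (hb : ∀ u v : Fin m → Fin N, (∑ π : Perm (Fin m), if ∀ k, u (π k) = v k then b π else 0) = 0) :
    ∑ π, b π • t π ∈ W := by
  classical
  induction hc : #(univ.filter fun π' : Perm (Fin m) =>
    ∃ π : Perm (Fin m), b π ≠ 0 ∧ toLex ⇑π' ≤ toLex ⇑π) using
    Nat.strong_induction_on generalizing b with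
  | _ c ih =>
  subst hc
  by_cases hb0 : ∀ π, b π = 0
  · simp [hb0]
  push Not at hb0
  obtain ⟨π₀, hπ₀⟩ := hb0
  obtain ⟨σ, hσ, hmax⟩ := exists_max_image (univ.filter fun π => b π ≠ 0)
    (fun π : Perm (Fin m) => toLex ⇑π) ⟨π₀, by simpa using hπ₀⟩
  simp only [mem_filter, mem_univ, true_and] at hσ hmax
  by_cases hgood : ∀ i, decreasingRank σ i ≤ N
  · refine absurd ?_ hσ
    have hpos : ∀ i, 1 ≤ decreasingRank σ i := fun i =>
      card_le_decreasingRank (S := {i}) (by simp) (by simp) (by simp [StrictAntiOn])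
    let v : Fin m → Fin N := fun i =>
      ⟨decreasingRank σ i - 1, by have := hpos i; have := hgood i; omega⟩
    have hv : ∀ i j, v i = v j → decreasingRank σ i = decreasingRank σ j := by
      intro i j h
      have := Fin.mk.inj h
      have := hpos i
      have := hpos j
      omega
    have h := hb (fun i => v (σ.symm i)) v
    rwa [sum_eq_single σ, if_pos (by simp)] at h
    · intro π _ hπ
      by_contra h'
      simp only [ite_eq_right_iff, not_forall] at h'
      obtain ⟨hm, hbπ⟩ := h'
      refine absurd (hmax π hbπ) (not_le.mpr (Perm.toLex_lt_of_first_ne hπ fun k hlt hk => ?_))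
      set j := σ.symm (π k) with hj
      have hσj : σ j = π k := by simp [hj]
      have hjk : j ≠ k := fun h => hk (by rw [← hσj, h])
      have hkj : k < j := by
        refine lt_of_le_of_ne (not_lt.mp fun h => hjk ?_) hjk.symm
        exact π.injective ((hlt j h).trans hσj)
      rw [← hσj]
      refine lt_of_le_of_ne (not_lt.mp fun h => ?_) fun h => hjk (σ.injective h).symm
      exact (decreasingRank_lt hkj h).ne (hv _ _ (hm k)).symm
    · exact fun h' => absurd (mem_univ _) h'
  · push Not at hgood
    obtain ⟨i, hi⟩ := hgood
    obtain ⟨S', -, -, hS', hcard⟩ := exists_card_eq_decreasingRank σ i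
    obtain ⟨S, hSS', hS⟩ := exists_subset_card_eq (show N + 1 ≤ #S' by omega)
    have hanti : StrictAntiOn σ S := hS'.mono (by exact_mod_cast hSS')
    let e : Perm (Fin m) → K := fun π =>
      ∑ τ ∈ permsOn S, ((Perm.sign τ : ℤˣ) : ℤ) • if σ * τ = π then 1 else 0
    have h1 := ht σ S hS
    have h2 : ∑ π, (b π - b σ * e π) • t π ∈ W := by
      refine ih _ (card_lt_card ?_) _ ?_ rfl
      · have hb' : ∀ π, b π - b σ * e π ≠ 0 → toLex ⇑π < toLex ⇑σ := by
          intro π hπ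
          by_contra hlt
          have hle := not_lt.mp hlt
          rcases hle.eq_or_lt with heq | hlt
          · obtain rfl : σ = π := DFunLike.coe_injective (toLex.injective heq)
            refine hπ ?_
            have : e σ = 1 := by
              simp only [e]
              rw [sum_eq_single 1]
              · simp
              · intro τ _ hτ
                simp [hτ]
              · intro h
                exact absurd (mem_permsOn.mpr fun _ _ => rfl) h
            rw [this, mul_one, sub_self]
          · refine hπ ?_
            have hbπ : b π = 0 := by
              by_contra h
              exact absurd (hmax π h) (not_le.mpr hlt)
            have : e π = 0 := by
              refine sum_eq_zero fun τ hτ => ?_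
              rw [if_neg, smul_zero]
              rintro rfl
              by_cases hτ1 : τ = 1
              · simp [hτ1] at hlt
              · exact absurd hlt (not_lt.mpr (Perm.toLex_mul_lt hanti hτ hτ1).le)
            rw [hbπ, this, mul_zero, sub_zero]
        refine (ssubset_iff_of_subset fun π' h => ?_).mpr ⟨σ, ?_, fun h => ?_⟩
        · obtain ⟨π, hπ, hle⟩ := (mem_filter.mp h).2
          exact mem_filter.mpr ⟨mem_univ _, σ, hσ, hle.trans (hb' π hπ).le⟩
        · exact mem_filter.mpr ⟨mem_univ _, σ, hσ, le_rfl⟩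
        · obtain ⟨π, hπ, hle⟩ := (mem_filter.mp h).2
          exact absurd hle (not_le.mpr (hb' π hπ))
      · intro u v
        obtain ⟨x, hx, y, hy, hxy, huxy⟩ : ∃ x ∈ S, ∃ y ∈ S, x ≠ y ∧ u (σ x) = u (σ y) :=
          exists_ne_map_eq_of_card_lt_of_maps_to (t := univ) (by simp [hS]) (by simp [Set.MapsTo])
        have h3 := sum_sum_sign_ite_smul (K := K) σ S
          fun π => if ∀ k, u (π k) = v k then (1 : K) else 0
        rw [sum_sign_eq_zero_of_swap hx hy hxy] at h3
        · have h4 : ∀ π : Perm (Fin m), (if ∀ k, u (π k) = v k then b π - b σ * e π else 0) =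
              (if ∀ k, u (π k) = v k then b π else 0) -
                b σ * (e π • if ∀ k, u (π k) = v k then (1 : K) else 0) := by
            intro π
            split_ifs <;> simp
          rw [sum_congr rfl fun π _ => h4 π, sum_sub_distrib, hb, ← mul_sum, h3, mul_zero, sub_zero]
        · intro τ
          have : ∀ z, u (σ (swap x y z)) = u (σ z) := by
            intro z
            rcases eq_or_ne z x with rfl | hzx
            · rw [swap_apply_left, huxy]
            · rcases eq_or_ne z y with rfl | hzy
              · rw [swap_apply_right, huxy]
              · rw [swap_apply_of_ne_of_ne hzx hzy]
          exact if_congr (forall_congr' fun k => by simp only [Perm.mul_apply, this]) rfl rfl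
    have h6 : ∑ π, b π • t π = ∑ π, (b π - b σ * e π) • t π +
        b σ • ∑ τ ∈ permsOn S, ((Perm.sign τ : ℤˣ) : ℤ) • t (σ * τ) := by
      rw [← sum_sum_sign_ite_smul (K := K) σ S t, smul_sum, ← sum_add_distrib]
      refine sum_congr rfl fun π _ => ?_
      rw [smul_smul, ← add_smul, sub_add_cancel]
    rw [h6]
    exact W.add_mem h2 (W.smul_mem _ h1)

end Straightening

section SplitOff

open Equiv Finset Function

variable {α ι K : Type*} [Fintype α] [DecidableEq α] [Fintype ι] [DecidableEq ι] [CommRing K]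

omit [DecidableEq ι] in
theorem permTrace_update_of_fixed {π : Perm α} {a : α} (ha : π a = a) (B : α → Matrix ι ι K) :
    ∃ c : K, ∀ M, permTrace π (update B a M) = M.trace * c := by
  by_cases hι : IsEmpty ι
  · refine ⟨0, fun M => ?_⟩
    have : IsEmpty (α → ι) := ⟨fun f => hι.elim (f a)⟩
    simp [permTrace]
  obtain ⟨z₀⟩ := not_isEmpty_iff.mp hι
  let e := (Equiv.funSplitAt a ι).symm
  refine ⟨∑ w : {j // j ≠ a} → ι, ∏ k ∈ univ.erase a, B k (e (z₀, w) k) (e (z₀, w) (π k)),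
    fun M => ?_⟩
  rw [permTrace, ← e.sum_comp, Fintype.sum_prod_type, Matrix.trace, sum_mul_sum]
  refine sum_congr rfl fun z _ => sum_congr rfl fun w _ => ?_
  have he : ∀ k, k ≠ a → e (z, w) k = e (z₀, w) k := fun k hk => by
    simp [e, Equiv.funSplitAt, Equiv.piSplitAt, hk]
  have hea : e (z, w) a = z := by simp [e, Equiv.funSplitAt, Equiv.piSplitAt]
  rw [← mul_prod_erase univ _ (mem_univ a), ha, update_self, hea, Matrix.diag_apply]
  congr 1
  refine prod_congr rfl fun k hk => ?_
  have hk := ne_of_mem_erase hk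
  rw [update_of_ne hk, he k hk, he _ fun h => hk (π.injective (h.trans ha.symm))]

/-- Splitting the point `a` off its cycle. -/
theorem permTrace_split [Nonempty ι] [IsAddTorsionFree K] {π : Perm α} {a : α} (ha : π a ≠ a)
    (B : α → Matrix ι ι K) :
    permTrace (swap a (π a) * π) B = (B a).trace * permTrace π (update B a 1) := by
  obtain ⟨c, hc⟩ := permTrace_update_of_fixed (π := swap a (π a) * π) (a := a) (by simp) B
  have h1 := hc (B a)
  rw [update_eq_self] at h1
  rw [h1]
  congr 1
  have h2 := hc 1
  have h3 := permTrace_merge π a ha (update B a 1)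
  have h4 : update (update (update B a 1) (π a) (update B a 1 a * update B a 1 (π a))) a 1 =
      update B a 1 := by
    rw [update_self, one_mul, update_eq_self, update_idem]
  rw [h4, h2, Matrix.trace_one, ← nsmul_eq_mul, ← nsmul_eq_mul] at h3
  exact (nsmul_right_injective Fintype.card_ne_zero h3).symm

end SplitOff

section Central

open Equiv Finset Function

theorem cycleWalk_finRotate {d : ℕ} (hd : d ≠ 0) :
    CycleWalk (finRotate (d + 1)) (Fin.last d) (Fin.last d) (List.finRange (d + 1)) := by
  have key : ∀ k i : ℕ, (h : i + k + 1 = d) → CycleWalk (finRotate (d + 1)) (Fin.last d)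
      ⟨i, by omega⟩ ((List.finRange (d + 1)).drop (i + 1)) := by
    intro k
    induction k with
    | zero =>
      intro i h
      have h1 : finRotate (d + 1) ⟨i, by omega⟩ = Fin.last d := by
        rw [finRotate_of_lt (by omega)]
        exact Fin.ext h
      have h2 : (List.finRange (d + 1)).drop (i + 1) = [Fin.last d] := by
        rw [List.drop_eq_getElem_cons (by simp; omega)]
        rw [List.drop_eq_nil_of_le (by simp; omega)]
        simp [Fin.ext_iff]
        omega
      rw [h2]
      exact .last h1
    | succ k ih =>
      intro i h
      have h1 : finRotate (d + 1) ⟨i, by omega⟩ = ⟨i + 1, by omega⟩ :=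
        finRotate_of_lt (by omega)
      rw [List.drop_eq_getElem_cons (by simp; omega)]
      have h2 : (List.finRange (d + 1))[i + 1]'(by simp; omega) =
          finRotate (d + 1) ⟨i, by omega⟩ := by
        rw [h1]; simp
      rw [h2]
      refine .step ?_ ?_
      · rw [h1, Ne, Fin.ext_iff, Fin.val_last]
        simp only
        omega
      · rw [h1]
        exact ih (i + 1) (by omega)
  have h0 : finRotate (d + 1) (Fin.last d) = 0 := finRotate_last
  have h1 : List.finRange (d + 1) = finRotate (d + 1) (Fin.last d) ::
      (List.finRange (d + 1)).drop 1 := by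
    rw [h0, List.finRange_succ]
    simp
  rw [h1]
  have h2 : (0 : Fin (d + 1)) ≠ Fin.last d := by
    rw [Ne, Fin.ext_iff]
    simpa using hd.symm
  refine .step (by rwa [h0]) ?_
  rw [h0]
  exact key (d - 1) 0 (by omega)

/-- The multilinear noncommutative polynomial with the given coefficients. -/
def multilinearPoly {F A : Type*} [Semiring F] [Semiring A] [Module F A] {d : ℕ}
    (γ : Perm (Fin d) → F) (y : Fin d → A) : A :=
  ∑ ρ, γ ρ • (List.ofFn fun j => y (ρ j)).prod

variable {F K R : Type*} [Field F] [CharZero F] [CommRing K] [IsAddTorsionFree K] [Algebra F K]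
  [Ring R] [IsAddTorsionFree R] [Algebra K R] [Algebra F R] [IsScalarTower F K R] {n d : ℕ}

/-- The cycle `ρ 0, …, ρ (d - 1), d`. -/
noncomputable def permCycle (ρ : Perm (Fin d)) : Perm (Fin (d + 1)) :=
  ρ.viaEmbedding Fin.castSuccEmb * finRotate (d + 1) * (ρ.viaEmbedding Fin.castSuccEmb)⁻¹

theorem viaEmbedding_castSuccEmb_last (ρ : Perm (Fin d)) :
    ρ.viaEmbedding Fin.castSuccEmb (Fin.last d) = Fin.last d :=
  Perm.viaEmbedding_apply_of_notMem _ _ _ (by simp)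

theorem viaEmbedding_castSuccEmb_castSucc (ρ : Perm (Fin d)) (j : Fin d) :
    ρ.viaEmbedding Fin.castSuccEmb j.castSucc = (ρ j).castSucc :=
  Perm.viaEmbedding_apply _ _ _

theorem permCycle_last_ne (hd : d ≠ 0) (ρ : Perm (Fin d)) :
    permCycle ρ (Fin.last d) ≠ Fin.last d := by
  have h : (ρ.viaEmbedding Fin.castSuccEmb)⁻¹ (Fin.last d) = Fin.last d := by
    rw [Perm.inv_eq_iff_eq, viaEmbedding_castSuccEmb_last]
  intro h'
  rw [permCycle, Perm.mul_apply, Perm.mul_apply, h, finRotate_last,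
    ← viaEmbedding_castSuccEmb_last ρ] at h'
  have := (ρ.viaEmbedding Fin.castSuccEmb).injective h'
  rw [Fin.ext_iff] at this
  exact hd (by simpa using this.symm)

theorem permTrace_permCycle {ι : Type*} [Fintype ι] [DecidableEq ι] {K : Type*} [CommRing K]
    (ρ : Perm (Fin d)) (B : Fin (d + 1) → Matrix ι ι K) :
    permTrace (permCycle ρ) B =
      ((List.ofFn fun j => B (ρ j).castSucc).prod * B (Fin.last d)).trace := by
  rw [permCycle, permTrace_conj, permTrace_finRotate, List.ofFn_succ']
  simp only [viaEmbedding_castSuccEmb_castSucc, viaEmbedding_castSuccEmb_last,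
    List.concat_eq_append, List.prod_append, List.prod_singleton]

variable (Φ : R →ₐ[K] Matrix (Fin n) (Fin n) K)

omit [IsAddTorsionFree K] [IsAddTorsionFree R] in
theorem traceMonomial_permCycle (hd : d ≠ 0) (ρ : Perm (Fin d)) (H : Fin d → R) :
    traceMonomial Φ (permCycle ρ) (Fin.last d) (Fin.snoc H 1 : Fin (d + 1) → R) =
      (n : K) • (List.ofFn fun j => H (ρ j)).prod := by
  have h := traceMonomial_conj Φ (ρ.viaEmbedding Fin.castSuccEmb) (finRotate (d + 1)) (Fin.last d)
    (Fin.snoc H 1 : Fin (d + 1) → R)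
  rw [viaEmbedding_castSuccEmb_last] at h
  rw [permCycle, h, traceMonomial_eq Φ (cycleWalk_finRotate hd)]
  congr 1
  · simp only [List.mem_finRange, if_true]
    rw [permTrace_finRotate]
    simp
  · rw [← List.ofFn_eq_map, List.ofFn_succ']
    simp [viaEmbedding_castSuccEmb_castSucc, viaEmbedding_castSuccEmb_last]

omit [IsAddTorsionFree R] in
theorem traceMonomial_swap_permCycle [NeZero n] (hd : d ≠ 0) (ρ : Perm (Fin d)) (H : Fin d → R) :
    traceMonomial Φ (swap (Fin.last d) (permCycle ρ (Fin.last d)) * permCycle ρ) (Fin.last d)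
        (Fin.snoc H 1 : Fin (d + 1) → R) =
      (n : K) • algebraMap K R (Φ (List.ofFn fun j => H (ρ j)).prod).trace := by
  rw [traceMonomial_fixed Φ (by simp), permTrace_split (permCycle_last_ne hd ρ),
    update_idem, permTrace_permCycle]
  simp only [update_self, Matrix.trace_one, Fintype.card_fin, Fin.snoc_last, mul_one]
  rw [mul_smul, ← Algebra.algebraMap_eq_smul_one, map_list_prod, List.map_ofFn]
  congr 5
  funext j
  simp [(Fin.castSucc_lt_last _).ne]

variable {J : Ideal R} (hJr : ∀ x ∈ J, ∀ r, x * r ∈ J)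
  (hJd : ∀ (m : ℕ) (x : R), m ≠ 0 → m • x ∈ J → x ∈ J)
  (hJ : ∀ h : R, ∑ i ∈ range (n + 1),
    algebraMap K R ((Φ h).charpoly.coeff i) * h ^ i ∈ J)

include hJr hJd hJ

/-- A multilinear central polynomial equals its normalized trace modulo the Cayley–Hamilton
identity. -/
theorem smul_multilinearPoly_sub_trace_mem [Nontrivial K] [NeZero n] (hd : d ≠ 0)
    (γ : Perm (Fin d) → F)
    (hγ : ∀ B : Fin d → Matrix (Fin n) (Fin n) F, ∃ s : F, multilinearPoly γ B = s • 1)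
    (H : Fin d → R) :
    (n : K) • multilinearPoly γ H - algebraMap K R (Φ (multilinearPoly γ H)).trace ∈ J := by
  let π' : Perm (Fin d) → Perm (Fin (d + 1)) := fun ρ =>
    swap (Fin.last d) (permCycle ρ (Fin.last d)) * permCycle ρ
  let b : Perm (Fin (d + 1)) → F := fun π => ∑ ρ, γ ρ *
    ((n : F) * (if permCycle ρ = π then 1 else 0) - if π' ρ = π then 1 else 0)
  have hb1 : ∀ f : Perm (Fin (d + 1)) → F, ∑ π, b π * f π =
      ∑ ρ, γ ρ * ((n : F) * f (permCycle ρ) - f (π' ρ)) := by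
    intro f
    simp only [b, sum_mul]
    rw [sum_comm]
    refine sum_congr rfl fun ρ _ => ?_
    simp [mul_assoc, ← mul_sum, sub_mul, sum_sub_distrib]
  have hb2 : ∀ f : Perm (Fin (d + 1)) → R, ∑ π, b π • f π =
      ∑ ρ, γ ρ • ((n : F) • f (permCycle ρ) - f (π' ρ)) := by
    intro f
    simp only [b, sum_smul]
    rw [sum_comm]
    refine sum_congr rfl fun ρ _ => ?_
    simp [mul_smul, ← smul_sum, sub_smul, sum_sub_distrib, ite_smul]
  have hker : ∀ u v : Fin (d + 1) → Fin n,
      (∑ π : Perm (Fin (d + 1)), if ∀ k, u (π k) = v k then b π else 0) = 0 := by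
    intro u v
    let B : Fin (d + 1) → Matrix (Fin n) (Fin n) F := fun k => Matrix.single (u k) (v k) 1
    have h1 : (∑ π : Perm (Fin (d + 1)), if ∀ k, u (π k) = v k then b π else 0) =
        ∑ π, b π * permTrace π B := by
      simp only [B, permTrace_single, mul_ite, mul_one, mul_zero]
    obtain ⟨s, hs⟩ := hγ fun j => B j.castSucc
    have h2 : ∀ ρ, permTrace (π' ρ) B = (B (Fin.last d)).trace *
        (List.ofFn fun j => B (ρ j).castSucc).prod.trace := by
      intro ρ
      have hne : ∀ j : Fin d, j.castSucc ≠ Fin.last d := fun j => (Fin.castSucc_lt_last j).ne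
      rw [permTrace_split (permCycle_last_ne hd ρ), permTrace_permCycle]
      simp only [update_self, mul_one, update_of_ne (hne _)]
    have h3 : ∑ ρ, γ ρ * ((List.ofFn fun j => B (ρ j).castSucc).prod * B (Fin.last d)).trace =
        s * (B (Fin.last d)).trace := by
      have := congrArg (fun M => (M * B (Fin.last d)).trace) hs
      simpa only [multilinearPoly, sum_mul, Matrix.trace_sum, smul_mul_assoc, Matrix.trace_smul,
        smul_eq_mul, one_mul] using this
    have h4 : ∑ ρ, γ ρ * (List.ofFn fun j => B (ρ j).castSucc).prod.trace = s * n := by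
      have := congrArg Matrix.trace hs
      simpa only [multilinearPoly, Matrix.trace_sum, Matrix.trace_smul, smul_eq_mul,
        Matrix.trace_one, Fintype.card_fin] using this
    rw [h1, hb1]
    simp only [h2, permTrace_permCycle, mul_sub, sum_sub_distrib, mul_left_comm (γ _), ← mul_sum,
      h3, h4]
    ring
  have hmem := sum_smul_mem_of_forall_sum_eq_zero (N := n)
    (fun π => traceMonomial Φ π (Fin.last d) (Fin.snoc H 1 : Fin (d + 1) → R))
    (J.restrictScalars F) (fun σ S hS => antisymMonomial_mem Φ hJr hJd (by simpa using hJ)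
      (by simpa using hS) σ _ _) b hker
  rw [hb2] at hmem
  simp only [π', traceMonomial_permCycle Φ hd, traceMonomial_swap_permCycle Φ hd] at hmem
  refine hJd n _ (NeZero.ne n) ?_
  convert hmem using 1
  have h5 : algebraMap K R (Φ (multilinearPoly γ H)).trace =
      ∑ ρ, γ ρ • algebraMap K R (Φ (List.ofFn fun j => H (ρ j)).prod).trace := by
    have h6 : ∀ (c : F) (x : R), Φ (c • x) = c • Φ x := (Φ.restrictScalars F).map_smul_of_tower
    have h7 : ∀ (c : F) (x : K), algebraMap K R (c • x) = c • algebraMap K R x := fun c x => by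
      rw [Algebra.algebraMap_eq_smul_one, Algebra.algebraMap_eq_smul_one, smul_assoc]
    simp only [multilinearPoly, map_sum, h6, Matrix.trace_sum, Matrix.trace_smul, h7]
  rw [h5]
  simp only [multilinearPoly, Nat.cast_smul_eq_nsmul, smul_sub, smul_sum, sum_sub_distrib,
    smul_comm (n : ℕ) (γ _), Submodule.restrictScalars_mem]

end Central

section WordSum

open Equiv Finset Function

/-- The homogeneous noncommutative polynomial of degree `d` with the given coefficients. -/
def wordSum {F A κ : Type*} [Semiring F] [Semiring A] [Module F A] [Fintype κ] {d : ℕ}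
    (γ : (Fin d → κ) → F) (y : κ → A) : A :=
  ∑ w, γ w • (List.ofFn fun j => y (w j)).prod

section

variable {F A κ : Type*} [Field F] [Ring A] [Algebra F A] [Fintype κ] {d m : ℕ}

/-- Restitution of the polarizations of a homogeneous polynomial. -/
theorem sum_multilinearPoly_comp (γ : (Fin d → κ) → F) (y : κ → A) :
    ∑ w : Fin d → κ, multilinearPoly (fun ρ => γ (w ∘ ρ)) (fun j => y (w j)) =
      d.factorial • wordSum γ y := by
  simp only [multilinearPoly]
  rw [sum_comm, sum_congr rfl fun ρ _ => (ρ.symm.arrowCongr (Equiv.refl κ)).sum_comp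
    fun w => γ w • (List.ofFn fun j => y (w j)).prod]
  simp [wordSum, Fintype.card_perm]

variable [DecidableEq κ]

theorem sum_powerset_wordSum_eq (γ : (Fin d → κ) → F) (w₀ : Fin m → κ) (B : Fin m → A) :
    ∑ U : Finset (Fin m), (-1 : ℤ) ^ #U •
      wordSum γ (fun k => ∑ i ∈ U, if w₀ i = k then B i else 0) =
      ∑ w, γ w • ∑ U : Finset (Fin m), (-1 : ℤ) ^ #U •
        MultilinearMap.mkPiAlgebraFin F d A fun j => ∑ i ∈ U, if w₀ i = w j then B i else 0 := by
  simp only [wordSum, smul_sum, MultilinearMap.mkPiAlgebraFin_apply]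
  rw [sum_comm]
  simp only [smul_comm (γ _)]

theorem sum_powerset_wordSum_of_lt (hdm : d < m) (γ : (Fin d → κ) → F) (w₀ : Fin m → κ)
    (B : Fin m → A) :
    ∑ U : Finset (Fin m), (-1 : ℤ) ^ #U •
      wordSum γ (fun k => ∑ i ∈ U, if w₀ i = k then B i else 0) = 0 := by
  rw [sum_powerset_wordSum_eq]
  refine sum_eq_zero fun w _ => ?_
  rw [sum_powerset_neg_one_pow_multilinear_eq_zero (by simpa using hdm), smul_zero]

theorem sum_powerset_wordSum (γ : (Fin d → κ) → F) (w₀ : Fin d → κ) (B : Fin d → A) :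
    ∑ U : Finset (Fin d), (-1 : ℤ) ^ #U •
      wordSum γ (fun k => ∑ i ∈ U, if w₀ i = k then B i else 0) =
      (-1 : ℤ) ^ d • multilinearPoly (fun ρ => γ (w₀ ∘ ρ)) B := by
  rw [sum_powerset_wordSum_eq]
  simp only [sum_powerset_neg_one_pow_multilinear_perm, Fintype.card_fin,
    smul_comm (γ _) ((-1 : ℤ) ^ d)]
  rw [← smul_sum]
  congr 1
  simp only [smul_sum]
  rw [sum_comm]
  refine sum_congr rfl fun ρ _ => ?_
  rw [sum_eq_single (w₀ ∘ ρ)]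
  · simp
  · intro w _ hw
    obtain ⟨j, hj⟩ := Function.ne_iff.mp hw
    rw [MultilinearMap.map_coord_zero _ j (if_neg fun h => hj h.symm), smul_zero]
  · simp

end

variable {F K R κ : Type*} [Field F] [CharZero F] [CommRing K] [IsAddTorsionFree K] [Algebra F K]
  [Ring R] [IsAddTorsionFree R] [Algebra K R] [Algebra F R] [IsScalarTower F K R] {n : ℕ}
  [Fintype κ]


variable (Φ : R →ₐ[K] Matrix (Fin n) (Fin n) K)

variable {J : Ideal R} (hJr : ∀ x ∈ J, ∀ r, x * r ∈ J)
  (hJd : ∀ (m : ℕ) (x : R), m ≠ 0 → m • x ∈ J → x ∈ J)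
  (hJ : ∀ h : R, ∑ i ∈ range (n + 1),
    algebraMap K R ((Φ h).charpoly.coeff i) * h ^ i ∈ J)

include hJr hJd hJ

/-- A central polynomial equals its normalized trace modulo the Cayley–Hamilton identity. -/
theorem smul_sum_wordSum_sub_trace_mem [Nontrivial K] [NeZero n] (D : ℕ)
    (γ : ∀ d, (Fin d → κ) → F)
    (hγ : ∀ A : κ → Matrix (Fin n) (Fin n) F,
      ∑ d ∈ range D, wordSum (γ d) A ∈ Submodule.span F {1}) (H : κ → R) :
    (n : K) • ∑ d ∈ range D, wordSum (γ d) H -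
      algebraMap K R (Φ (∑ d ∈ range D, wordSum (γ d) H)).trace ∈ J := by
  classical
  let G : R →+ R := (DistribSMul.toAddMonoidHom R (n : K)) - (algebraMap K R : K →+ R).comp
    ((Matrix.traceAddMonoidHom (Fin n) K).comp (Φ : R →+ Matrix (Fin n) (Fin n) K))
  change G _ ∈ J
  induction D with
  | zero => simp
  | succ D ih =>
    have h1 : ∀ (w₀ : Fin D → κ) (B : Fin D → Matrix (Fin n) (Fin n) F),
        multilinearPoly (fun ρ => γ D (w₀ ∘ ρ)) B ∈ Submodule.span F {1} := by
      intro w₀ B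
      have h2 : ∑ U : Finset (Fin D), (-1 : ℤ) ^ #U • ∑ d ∈ range (D + 1),
          wordSum (γ d) (fun k => ∑ i ∈ U, if w₀ i = k then B i else 0) ∈
            Submodule.span F {(1 : Matrix (Fin n) (Fin n) F)} :=
        sum_mem fun U _ => zsmul_mem (hγ _) _
      simp only [smul_sum] at h2
      rw [sum_comm, sum_range_succ, sum_powerset_wordSum,
        sum_eq_zero fun d hd => sum_powerset_wordSum_of_lt (mem_range.mp hd) _ _ _, zero_add] at h2
      have h3 := zsmul_mem h2 ((-1 : ℤ) ^ D)
      rwa [smul_smul, ← mul_pow, neg_one_mul, neg_neg, one_pow, one_smul] at h3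
    have h4 : ∀ A : κ → Matrix (Fin n) (Fin n) F, wordSum (γ D) A ∈ Submodule.span F {1} := by
      intro A
      have h5 : D.factorial • wordSum (γ D) A ∈
          Submodule.span F {(1 : Matrix (Fin n) (Fin n) F)} := by
        rw [← sum_multilinearPoly_comp]
        exact sum_mem fun w _ => h1 w _
      rw [← Nat.cast_smul_eq_nsmul F] at h5
      exact (Submodule.smul_mem_iff _ (Nat.cast_ne_zero.mpr D.factorial_ne_zero)).mp h5
    rw [sum_range_succ, map_add]
    refine J.add_mem (ih fun A => ?_) (hJd _ _ D.factorial_ne_zero ?_)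
    · have := sub_mem (hγ A) (h4 A)
      rwa [sum_range_succ, add_sub_cancel_right] at this
    rw [← map_nsmul, ← sum_multilinearPoly_comp, map_sum]
    refine sum_mem fun w _ => ?_
    rcases eq_or_ne D 0 with rfl | hD
    · have h6 : multilinearPoly (fun ρ => γ 0 (w ∘ ρ)) (fun j => H (w j)) =
          algebraMap K R (algebraMap F K (γ 0 (w ∘ (1 : Perm (Fin 0))))) := by
        rw [← IsScalarTower.algebraMap_apply, Algebra.algebraMap_eq_smul_one]
        simp [multilinearPoly]
      rw [h6]
      convert J.zero_mem
      simp [G, Algebra.smul_def, Matrix.algebraMap_eq_diagonal, Matrix.trace]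
    · exact smul_multilinearPoly_sub_trace_mem Φ hJr hJd hJ hD _
        (fun B => by simpa [Submodule.mem_span_singleton, eq_comm] using h1 w B) _

end WordSum

section FreeAlgebraLemmas

open Finset

/-- The ring homomorphism out of a free algebra that is `f` on coefficients and `g` on the
generators. -/
def FreeAlgebra.semilift {K L A X : Type*} [CommSemiring K] [CommSemiring L] [Semiring A]
    [Algebra L A] (f : K →+* L) (g : X → A) : FreeAlgebra K X →+* A :=
  letI := ((algebraMap L A).comp f).toAlgebra' fun c x => Algebra.commutes (f c) x
  (FreeAlgebra.lift K g : FreeAlgebra K X →+* A)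

theorem FreeAlgebra.semilift_algebraMap {K L A X : Type*} [CommSemiring K] [CommSemiring L]
    [Semiring A] [Algebra L A] (f : K →+* L) (g : X → A) (c : K) :
    FreeAlgebra.semilift f g (algebraMap K _ c) = algebraMap L A (f c) :=
  letI := ((algebraMap L A).comp f).toAlgebra' fun c x => Algebra.commutes (f c) x
  (FreeAlgebra.lift K g).commutes c

theorem FreeAlgebra.semilift_ι {K L A X : Type*} [CommSemiring K] [CommSemiring L]
    [Semiring A] [Algebra L A] (f : K →+* L) (g : X → A) (x : X) :
    FreeAlgebra.semilift f g (FreeAlgebra.ι K x) = g x :=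
  letI := ((algebraMap L A).comp f).toAlgebra' fun c x => Algebra.commutes (f c) x
  FreeAlgebra.lift_ι_apply g x

/-- Every element of a free algebra is a finite sum of homogeneous polynomials in finitely many
generators. -/
theorem FreeAlgebra.exists_eq_sum_wordSum {F : Type*} [Field F] (c : FreeAlgebra F ℕ) :
    ∃ (N D : ℕ) (γ : ∀ d, (Fin d → Fin N) → F),
      c = ∑ d ∈ range D, wordSum (γ d) fun k => FreeAlgebra.ι F (k : ℕ) := by
  obtain ⟨l, hl⟩ : ∃ l : List ℕ →₀ F, c = l.sum fun w a => a • (w.map (FreeAlgebra.ι F)).prod := by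
    induction c using FreeAlgebra.induction with
    | grade0 r => exact ⟨.single [] r, by simp [Algebra.algebraMap_eq_smul_one]⟩
    | grade1 x => exact ⟨.single [x] 1, by simp⟩
    | mul a b ha hb =>
      obtain ⟨l, rfl⟩ := ha
      obtain ⟨l', rfl⟩ := hb
      refine ⟨l.sum fun w a => l'.sum fun w' a' => .single (w ++ w') (a * a'), ?_⟩
      rw [Finsupp.sum_sum_index (by simp) (by simp [add_smul]), Finsupp.sum_mul]
      refine Finsupp.sum_congr fun w _ => ?_
      rw [Finsupp.sum_sum_index (by simp) (by simp [add_smul]), Finsupp.mul_sum]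
      refine Finsupp.sum_congr fun w' _ => ?_
      rw [Finsupp.sum_single_index (by simp), List.map_append, List.prod_append,
        smul_mul_smul_comm]
    | add a b ha hb =>
      obtain ⟨l, rfl⟩ := ha
      obtain ⟨l', rfl⟩ := hb
      exact ⟨l + l', by rw [Finsupp.sum_add_index' (by simp) (by simp [add_smul])]⟩
  obtain ⟨N, hN⟩ : ∃ N : ℕ, ∀ w ∈ l.support, ∀ x ∈ w, x < N := by
    refine ⟨(l.support.sup fun w => w.sum) + 1, fun w hw x hx => Nat.lt_succ_of_le ?_⟩
    exact (List.le_sum_of_mem hx).trans (le_sup (f := fun w : List ℕ => w.sum) hw)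
  obtain ⟨D, hD⟩ : ∃ D : ℕ, ∀ w ∈ l.support, w.length < D :=
    ⟨_, fun w hw => Nat.lt_succ_of_le (le_sup (f := List.length) hw)⟩
  refine ⟨N, D, fun d w => l (List.ofFn fun j => (w j : ℕ)), ?_⟩
  rw [hl, Finsupp.sum]
  simp only [wordSum]
  rw [sum_sigma']
  symm
  refine sum_bij_ne_zero (fun p _ _ => List.ofFn fun j => ((p.2 j : Fin N) : ℕ)) ?_ ?_ ?_ ?_
  · intro p _ hp
    rw [Finsupp.mem_support_iff]
    exact left_ne_zero_of_smul hp
  · rintro ⟨d, w⟩ _ _ ⟨d', w'⟩ _ _ h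
    have hd : d = d' := by simpa using congrArg List.length h
    subst hd
    have := List.ofFn_injective h
    congr 1
    funext j
    exact Fin.ext (congrFun this j)
  · intro w hw hw0
    refine ⟨⟨w.length, fun j => ⟨w.get j, hN w hw _ (w.get_mem j)⟩⟩, ?_, ?_, ?_⟩
    · simpa using hD w hw
    · simpa [← List.ofFn_eq_map, Function.comp_def, List.ofFn_comp'] using hw0
    · simp
  · intro p _ _
    simp [List.map_ofFn, Function.comp_def]

theorem map_wordSum {F A B κ : Type*} [CommSemiring F] [Semiring A] [Semiring B] [Algebra F A]
    [Algebra F B] [Fintype κ] {d : ℕ} (f : A →ₐ[F] B) (γ : (Fin d → κ) → F) (y : κ → A) :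
    f (wordSum γ y) = wordSum γ fun k => f (y k) := by
  simp [wordSum, map_list_prod, List.map_ofFn, Function.comp_def]

end FreeAlgebraLemmas

section Assembly

open Finset

variable {F n}

/-- The substitution of the generic matrix entries induced by sending every generator to `h`. -/
noncomputable def constSubstCoeff (h : QPoly F n) : CPoly F n →ₐ[F] CPoly F n :=
  MvPolynomial.aeval fun p => PhiQ F n h p.1 p.2.1

/-- The substitution endomorphism sending every generator to `h`. -/
noncomputable def constSubst (h : QPoly F n) : QPoly F n →ₐ[F] QPoly F n :=
  { FreeAlgebra.semilift (constSubstCoeff h : CPoly F n →+* CPoly F n) fun _ => h with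
    commutes' := fun r => by
      rw [IsScalarTower.algebraMap_apply F (CPoly F n) (QPoly F n)]
      exact (FreeAlgebra.semilift_algebraMap _ _ _).trans
        (congrArg _ ((constSubstCoeff h).commutes r)) }

omit [CharZero F] in
theorem constSubst_algebraMap (h : QPoly F n) (p : CPoly F n) :
    constSubst h (algebraMap _ _ p) = algebraMap _ _ (constSubstCoeff h p) :=
  FreeAlgebra.semilift_algebraMap _ _ _

omit [CharZero F] in
theorem constSubst_ι (h : QPoly F n) (k : ℕ) : constSubst h (FreeAlgebra.ι _ k) = h :=
  FreeAlgebra.semilift_ι _ _ _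

omit [CharZero F] in
theorem isSubstEndo_constSubst (h : QPoly F n) : IsSubstEndo F n (constSubst h) := by
  intro i j k
  rw [constSubst_algebraMap, constSubst_ι, constSubstCoeff, MvPolynomial.aeval_X]

omit [CharZero F] in
theorem constSubst_chQ (h : QPoly F n) :
    constSubst h (chQ F n) = ∑ i ∈ range (n + 1),
      algebraMap (CPoly F n) (QPoly F n) ((PhiQ F n h).charpoly.coeff i) * h ^ i := by
  rw [chQ, map_sum]
  refine sum_congr rfl fun i _ => ?_
  rw [map_mul, map_pow, constSubst_algebraMap, constSubst_ι]
  congr 2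
  have h1 : PhiQ F n h = (genMat F n 0).map (constSubstCoeff h : CPoly F n →+* CPoly F n) := by
    ext1 i j
    simp [constSubstCoeff, genMat]
  rw [h1, Matrix.charpoly_map, Polynomial.coeff_map]
  rfl

omit [CharZero F] in
theorem evalQ_toQPoly (A : ℕ → Matrix (Fin n) (Fin n) F) (c : NCPoly F) :
    evalQ F n A (toQPoly F n c) = evalNC F n A c := by
  have h : (evalQ F n A).comp (toQPoly F n) = evalNC F n A := by
    ext k i j
    simp [evalQ, toQPoly, evalNC, PhiQ, genMat, evalC]
  exact DFunLike.congr_fun h c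

omit [CharZero F] in
theorem evalQ_algebraMap_trace (A : ℕ → Matrix (Fin n) (Fin n) F) (a : F) (P : QPoly F n) :
    evalQ F n A (algebraMap (CPoly F n) (QPoly F n) (a • (PhiQ F n P).trace)) =
      (a * (evalQ F n A P).trace) • (1 : Matrix (Fin n) (Fin n) F) := by
  have h : ∀ p : CPoly F n, evalQ F n A (algebraMap (CPoly F n) (QPoly F n) p) =
      evalC F n A p • (1 : Matrix (Fin n) (Fin n) F) := by
    intro p
    rw [evalQ, AlgHom.comp_apply, AlgHom.restrictScalars_apply, AlgHom.commutes,
      Matrix.algebraMap_eq_diagonal, AlgHom.mapMatrix_apply, Matrix.diagonal_map (map_zero _),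
      Matrix.smul_one_eq_diagonal]
    rfl
  rw [h, map_smul, smul_eq_mul]
  congr 2
  simp [evalQ, Matrix.trace, map_sum]

theorem isQuasiIdentity_sub_trace (hn : 1 ≤ n) {c : NCPoly F} (hc : IsCentralPoly F n c) :
    IsQuasiIdentity F n (toQPoly F n c - algebraMap (CPoly F n) (QPoly F n)
      ((n : F)⁻¹ • Matrix.trace (PhiQ F n (toQPoly F n c)))) := by
  intro A
  obtain ⟨s, hs⟩ := hc A
  have hn0 : (n : F) ≠ 0 := Nat.cast_ne_zero.mpr (by omega)
  rw [map_sub, evalQ_algebraMap_trace, evalQ_toQPoly, hs, Matrix.trace_smul, Matrix.trace_one,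
    Fintype.card_fin, smul_eq_mul, mul_left_comm, inv_mul_cancel₀ hn0, mul_one, sub_self]

omit [CharZero F] in
theorem sum_wordSum_mem_span {N D : ℕ} {γ : ∀ d, (Fin d → Fin N) → F}
    (hc : IsCentralPoly F n (∑ d ∈ range D, wordSum (γ d) fun k => FreeAlgebra.ι F (k : ℕ)))
    (A : Fin N → Matrix (Fin n) (Fin n) F) :
    ∑ d ∈ range D, wordSum (γ d) A ∈ Submodule.span F {1} := by
  obtain ⟨s, hs⟩ := hc fun k => if h : k < N then A ⟨k, h⟩ else 0
  rw [Submodule.mem_span_singleton]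
  refine ⟨s, hs.symm.trans ?_⟩
  simp [map_sum, map_wordSum, evalNC]

theorem sub_trace_mem_of_isTIdeal (hn : 1 ≤ n) {c : NCPoly F} (hc : IsCentralPoly F n c)
    {I : Set (QPoly F n)} (hI : IsTIdeal F n I) (hch : chQ F n ∈ I) :
    toQPoly F n c - algebraMap (CPoly F n) (QPoly F n)
      ((n : F)⁻¹ • Matrix.trace (PhiQ F n (toQPoly F n c))) ∈ I := by
  obtain ⟨h0, hadd, hl, hr, hsub⟩ := hI
  have : NeZero n := ⟨by omega⟩
  let J : Ideal (QPoly F n) :=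
    { carrier := I, zero_mem' := h0, add_mem' := hadd _ _, smul_mem' := hl }
  have hJF : ∀ (a : F) x, x ∈ J → a • x ∈ J := fun a x hx => by
    rw [Algebra.smul_def]
    exact J.mul_mem_left _ hx
  obtain ⟨N, D, γ, rfl⟩ := FreeAlgebra.exists_eq_sum_wordSum c
  have h := smul_sum_wordSum_sub_trace_mem (PhiQ F n) (J := J) (fun x hx r => hr r x hx)
    (fun m x hm hx => by
      have := hJF (m : F)⁻¹ _ hx
      rwa [← Nat.cast_smul_eq_nsmul F, inv_smul_smul₀ (Nat.cast_ne_zero.mpr hm)] at this)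
    (fun h => by
      rw [← constSubst_chQ]
      exact hsub _ (isSubstEndo_constSubst h) _ hch)
    D γ (sum_wordSum_mem_span hc) fun k => FreeAlgebra.ι (CPoly F n) (k : ℕ)
  have h1 : toQPoly F n (∑ d ∈ range D, wordSum (γ d) fun k => FreeAlgebra.ι F (k : ℕ)) =
      ∑ d ∈ range D, wordSum (γ d) fun k : Fin N => FreeAlgebra.ι (CPoly F n) (k : ℕ) := by
    simp [map_sum, map_wordSum, toQPoly]
  rw [h1]
  have h2 := hJF (n : F)⁻¹ _ h
  rw [smul_sub, Nat.cast_smul_eq_nsmul, ← Nat.cast_smul_eq_nsmul F,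
    inv_smul_smul₀ (NeZero.ne _)] at h2
  rwa [Algebra.algebraMap_eq_smul_one, smul_assoc, ← Algebra.algebraMap_eq_smul_one]

end Assembly

theorem stmt19 (F : Type*) [Field F] [CharZero F] (n : ℕ) (hn : 1 ≤ n)
    (c : NCPoly F) (hc : IsCentralPoly F n c) :
    IsQuasiIdentity F n
      (toQPoly F n c - algebraMap (CPoly F n) (QPoly F n)
        ((n : F)⁻¹ • Matrix.trace (PhiQ F n (toQPoly F n c)))) ∧
    (toQPoly F n c - algebraMap (CPoly F n) (QPoly F n)
        ((n : F)⁻¹ • Matrix.trace (PhiQ F n (toQPoly F n c)))) ∈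
      TIdealSpan F n {chQ F n} :=
  ⟨isQuasiIdentity_sub_trace hn hc, fun _ hI =>
    sub_trace_mem_of_isTIdeal hn hc hI.1 (hI.2 rfl)⟩
end
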